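/- arXiv:1903.03549 — 2 statements merged into one kernel-verified Lean document; each statement's English description precedes it below -/
import Mathlib

section
/- Let A_10 be the alternating group on 10 letters. The poset A_3(A_10) is connected, and its fundamental group π1(A_3(A_10)) is not a free group. -/
open Function

/-- The geometric realization of the order complex of the subposet `S` of `X`,
realized as a subspace of `X → ℝ`: convex combinations supported on finite
nonempty chains contained in `S`. -/
def geomRealOn {X : Type*} [Preorder X] (S : Set X) : Set (X → ℝ) :=
  {f | (∀ x, 0 ≤ f x) ∧ Function.support f ⊆ S ∧ IsChain (· ≤ ·) (Function.support f) ∧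
    ∃ s : Finset X, Function.support f ⊆ ↑s ∧ ∑ x ∈ s, f x = 1}

/-- A group is elementary abelian for the prime `p` if it is abelian and
every element has order dividing `p`. -/
def IsElementaryAbelian (p : ℕ) (G : Type*) [Group G] : Prop :=
  (∀ a b : G, a * b = b * a) ∧ ∀ a : G, a ^ p = 1

/-- The Quillen poset `A_p(G)`: nontrivial elementary abelian `p`-subgroups of `G`. -/
def apSet (p : ℕ) (G : Type*) [Group G] : Set (Subgroup G) :=
  {H | H ≠ ⊥ ∧ IsElementaryAbelian p ↥H}

open Topology unitInterval

/-- The displacement of a lift to `ℝ` of a homotopy class of paths in the circle `ℝ / ℤ`. -/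
noncomputable def circleDisplacement {a b : AddCircle (1 : ℝ)}
    (γ : Path.Homotopic.Quotient a b) : ℝ :=
  ((AddCircle.isCoveringMap_coe (1 : ℝ)).monodromy γ
    ⟨Quotient.out a, QuotientAddGroup.out_eq' a⟩ : ℝ) - Quotient.out a

theorem monodromy_addCircle_mk {a b : AddCircle (1 : ℝ)} (γ : Path a b) (Γ : C(I, ℝ))
    (h : ∀ t, ((Γ t : ℝ) : AddCircle (1 : ℝ)) = γ t) :
    ((AddCircle.isCoveringMap_coe (1 : ℝ)).monodromy (.mk γ)
      ⟨Γ 0, by simp [h]⟩ : ℝ) = Γ 1 := by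
  have := ((AddCircle.isCoveringMap_coe (1 : ℝ)).eq_liftPath_iff'
    (γ := (γ : C(I, AddCircle (1 : ℝ)))) (e := Γ 0) (γ_0 := (h 0).symm) (Γ := Γ)).2 ⟨funext h, rfl⟩
  exact congr($this 1).symm

theorem circleDisplacement_eq_of_lift {a b : AddCircle (1 : ℝ)} (γ : Path a b) (Γ : C(I, ℝ))
    (h : ∀ t, ((Γ t : ℝ) : AddCircle (1 : ℝ)) = γ t) :
    circleDisplacement (.mk γ) = Γ 1 - Γ 0 := by
  set r : ℝ := Quotient.out a with hr
  have ha : ((r : ℝ) : AddCircle (1 : ℝ)) = a := QuotientAddGroup.out_eq' a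
  let Γ' : C(I, ℝ) := Γ + .const _ (r - Γ 0)
  have h' : ∀ t, ((Γ' t : ℝ) : AddCircle (1 : ℝ)) = γ t := fun t ↦ by
    simp [Γ', h, ha]
  have h0 : Γ' 0 = r := by simp [Γ']
  have := monodromy_addCircle_mk γ Γ' h'
  unfold circleDisplacement
  simp only [h0] at this
  rw [this]
  simp only [Γ', ContinuousMap.add_apply, ContinuousMap.const_apply, ← hr]
  ring

theorem circleDisplacement_eq_monodromy_sub {a b : AddCircle (1 : ℝ)}
    (γ : Path.Homotopic.Quotient a b) (e : ((↑) : ℝ → AddCircle (1 : ℝ)) ⁻¹' {a}) :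
    circleDisplacement γ = ((AddCircle.isCoveringMap_coe (1 : ℝ)).monodromy γ e : ℝ) - e := by
  obtain ⟨γ, rfl⟩ := Path.Homotopic.Quotient.mk_surjective γ
  have cov := AddCircle.isCoveringMap_coe (1 : ℝ)
  have he : (γ : C(I, AddCircle (1 : ℝ))) 0 = ((e : ℝ) : AddCircle (1 : ℝ)) := by
    simpa using e.2.symm
  rw [circleDisplacement_eq_of_lift γ (cov.liftPath γ e he)
    (fun t ↦ congr_fun (cov.liftPath_lifts _ _ he) t), cov.liftPath_zero]
  rfl

theorem circleDisplacement_trans {a b c : AddCircle (1 : ℝ)}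
    (γ : Path.Homotopic.Quotient a b) (γ' : Path.Homotopic.Quotient b c) :
    circleDisplacement (γ.trans γ') = circleDisplacement γ + circleDisplacement γ' := by
  have e : ((↑) : ℝ → AddCircle (1 : ℝ)) ⁻¹' {a} := ⟨Quotient.out a, QuotientAddGroup.out_eq' a⟩
  have cov := AddCircle.isCoveringMap_coe (1 : ℝ)
  rw [circleDisplacement_eq_monodromy_sub _ e, circleDisplacement_eq_monodromy_sub γ e,
    circleDisplacement_eq_monodromy_sub γ' (cov.monodromy γ e), cov.monodromy_trans_apply]
  ring

/-- The displacement of the image of a homotopy class of paths under a circle-valued map. -/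
noncomputable def displacement {Y : Type*} [TopologicalSpace Y] (Θ : C(Y, AddCircle (1 : ℝ)))
    {a b : Y} (γ : Path.Homotopic.Quotient a b) : ℝ :=
  circleDisplacement (γ.map Θ)

theorem displacement_mk_eq_of_lift {Y : Type*} [TopologicalSpace Y] (Θ : C(Y, AddCircle (1 : ℝ)))
    {a b : Y} (γ : Path a b) (Γ : C(I, ℝ))
    (h : ∀ t, ((Γ t : ℝ) : AddCircle (1 : ℝ)) = Θ (γ t)) :
    displacement Θ (.mk γ) = Γ 1 - Γ 0 :=
  circleDisplacement_eq_of_lift (γ.map Θ.continuous) Γ h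

theorem displacement_trans {Y : Type*} [TopologicalSpace Y] (Θ : C(Y, AddCircle (1 : ℝ)))
    {a b c : Y} (γ : Path.Homotopic.Quotient a b) (γ' : Path.Homotopic.Quotient b c) :
    displacement Θ (γ.trans γ') = displacement Θ γ + displacement Θ γ' := by
  rw [displacement, displacement, displacement, ← circleDisplacement_trans]
  congr 1
  exact FundamentalGroupoid.map Θ |>.map_comp (X := ⟨a⟩) (Y := ⟨b⟩) (Z := ⟨c⟩) γ γ'

theorem displacement_symm {Y : Type*} [TopologicalSpace Y] (Θ : C(Y, AddCircle (1 : ℝ)))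
    {a b : Y} (γ : Path.Homotopic.Quotient a b) :
    displacement Θ γ.symm = - displacement Θ γ := by
  obtain ⟨γ, rfl⟩ := Path.Homotopic.Quotient.mk_surjective γ
  have cov := AddCircle.isCoveringMap_coe (1 : ℝ)
  have he : (Θ.comp (γ : C(I, Y))) 0 = ((Quotient.out (Θ a) : ℝ) : AddCircle (1 : ℝ)) := by
    simp
  let Γ := cov.liftPath (Θ.comp (γ : C(I, Y))) _ he
  have hΓ : ∀ t, ((Γ t : ℝ) : AddCircle (1 : ℝ)) = Θ (γ t) :=
    fun t ↦ congr_fun (cov.liftPath_lifts _ _ he) t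
  rw [displacement_mk_eq_of_lift Θ γ Γ hΓ, ← Path.Homotopic.Quotient.mk_symm,
    displacement_mk_eq_of_lift Θ γ.symm (Γ.comp ⟨σ, continuous_symm⟩) fun t ↦ hΓ _]
  simp

/-- The displacement as a homomorphism on the fundamental group. -/
noncomputable def displacementHom {Y : Type*} [TopologicalSpace Y]
    (Θ : C(Y, AddCircle (1 : ℝ))) (y : Y) : FundamentalGroup Y y →* Multiplicative ℝ :=
  MonoidHom.mk' (fun γ ↦ .ofAdd (displacement Θ (FundamentalGroup.toPath γ))) fun γ γ' ↦ by
    rw [← ofAdd_add, add_comm, ← displacement_trans]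
    rfl

theorem Path.Homotopic.Quotient.trans_conj_trans {Y : Type*} [TopologicalSpace Y]
    {a b c d e : Y} (α : Path.Homotopic.Quotient a b) (β : Path.Homotopic.Quotient b c)
    (γ : Path.Homotopic.Quotient a c) (δ : Path.Homotopic.Quotient c d)
    (ε : Path.Homotopic.Quotient e d) :
    ((α.trans β).trans γ.symm).trans ((γ.trans δ).trans ε.symm) =
      (α.trans (β.trans δ)).trans ε.symm := by
  simp only [Path.Homotopic.Quotient.trans_assoc]
  rw [← Path.Homotopic.Quotient.trans_assoc γ.symm, Path.Homotopic.Quotient.symm_trans,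
    Path.Homotopic.Quotient.refl_trans]

section ConvexSubset

variable {E : Type*} [AddCommGroup E] [Module ℝ E] [TopologicalSpace E] [ContinuousAdd E]
  [ContinuousSMul ℝ E]

/-- The straight-line path inside a convex subset of a subspace. -/
noncomputable def segmentPath {Y C : Set E} (hC : Convex ℝ C) (hCY : C ⊆ Y) {a b : Y}
    (ha : (a : E) ∈ C) (hb : (b : E) ∈ C) : Path a b where
  toFun t := ⟨(1 - (t : ℝ)) • (a : E) + (t : ℝ) • (b : E),
    hCY (hC ha hb (sub_nonneg.2 t.2.2) t.2.1 (by ring))⟩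
  continuous_toFun := by fun_prop
  source' := by simp
  target' := by simp

theorem segmentPath_apply {Y C : Set E} (hC : Convex ℝ C) (hCY : C ⊆ Y) {a b : Y}
    (ha : (a : E) ∈ C) (hb : (b : E) ∈ C) (t : I) :
    (segmentPath hC hCY ha hb t : E) = (1 - (t : ℝ)) • (a : E) + (t : ℝ) • (b : E) := rfl

theorem segmentPath_mem {Y C : Set E} (hC : Convex ℝ C) (hCY : C ⊆ Y) {a b : Y}
    (ha : (a : E) ∈ C) (hb : (b : E) ∈ C) (t : I) : (segmentPath hC hCY ha hb t : E) ∈ C :=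
  hC ha hb (sub_nonneg.2 t.2.2) t.2.1 (by ring)

theorem Path.homotopic_of_mem_convex {Y C : Set E} (hC : Convex ℝ C) (hCY : C ⊆ Y) {a b : Y}
    (p q : Path a b) (hp : ∀ t, (p t : E) ∈ C) (hq : ∀ t, (q t : E) ∈ C) : p.Homotopic q :=
  ⟨{ toFun := fun x ↦ ⟨(1 - (x.1 : ℝ)) • (p x.2 : E) + (x.1 : ℝ) • (q x.2 : E),
        hCY (hC (hp _) (hq _) (sub_nonneg.2 x.1.2.2) x.1.2.1 (by ring))⟩
     continuous_toFun := by fun_prop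
     map_zero_left := by simp
     map_one_left := by simp
     prop' := by
      rintro t x (rfl | rfl)
      · simp [← add_smul]
      · simp [← add_smul] }⟩

end ConvexSubset

section AdjIn

variable {X : Type*} [PartialOrder X] {S : Set X}

/-- Two elements of the subposet `S` that are comparable. -/
def AdjIn (S : Set X) (x y : X) : Prop := x ∈ S ∧ y ∈ S ∧ (x ≤ y ∨ y ≤ x)

theorem AdjIn.symm {x y : X} (h : AdjIn S x y) : AdjIn S y x := ⟨h.2.1, h.1, h.2.2.symm⟩

theorem AdjIn.isChain {x y : X} (h : AdjIn S x y) : IsChain (· ≤ ·) ({x, y} : Set X) := by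
  rintro a (rfl | rfl) b (rfl | rfl) hab <;>
    first | exact absurd rfl hab | exact h.2.2 | exact h.2.2.symm

theorem AdjIn.subset {x y : X} (h : AdjIn S x y) : ({x, y} : Set X) ⊆ S := by
  rintro z (rfl | rfl)
  exacts [h.1, h.2.1]

theorem adjIn_of_apply_ne_zero (f : geomRealOn S) {x y : X} (hx : (f : X → ℝ) x ≠ 0)
    (hy : (f : X → ℝ) y ≠ 0) : AdjIn S x y :=
  ⟨f.2.2.1 hx, f.2.2.1 hy, f.2.2.2.1.total hx hy⟩

end AdjIn

section OrderComplex

variable {X : Type*} [Fintype X]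

/-- The geometric simplex spanned by a set of vertices. -/
def geomFace (C : Set X) : Set (X → ℝ) :=
  {f | (∀ x, 0 ≤ f x) ∧ support f ⊆ C ∧ ∑ x, f x = 1}

theorem convex_geomFace (C : Set X) : Convex ℝ (geomFace C) := by
  rintro f ⟨hf, hfC, hf1⟩ g ⟨hg, hgC, hg1⟩ s t hs ht hst
  refine ⟨fun x ↦ ?_, fun x hx ↦ ?_, ?_⟩
  · have := hf x
    have := hg x
    simp only [Pi.add_apply, Pi.smul_apply, smul_eq_mul]
    positivity
  · by_contra hxC
    have h1 : f x = 0 := notMem_support.1 fun h ↦ hxC (hfC h)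
    have h2 : g x = 0 := notMem_support.1 fun h ↦ hxC (hgC h)
    simp [h1, h2] at hx
  · simp [Finset.sum_add_distrib, ← Finset.mul_sum, hf1, hg1, hst]

theorem single_mem_geomFace [DecidableEq X] {C : Set X} {x : X} (hx : x ∈ C) :
    (Pi.single x 1 : X → ℝ) ∈ geomFace C := by
  refine ⟨fun y ↦ ?_, fun y hy ↦ ?_, by simp⟩
  · by_cases h : y = x
    · subst h; simp
    · simp [h]
  · by_cases h : y = x
    · exact h ▸ hx
    · simp [h] at hy

variable [PartialOrder X] {S : Set X}

theorem sum_eq_one_of_mem_geomRealOn {f : X → ℝ} (hf : f ∈ geomRealOn S) : ∑ x, f x = 1 := by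
  obtain ⟨-, -, -, s, hs, h⟩ := hf
  rw [← h]
  refine (Finset.sum_subset (Finset.subset_univ s) fun x _ hx ↦ ?_).symm
  exact notMem_support.1 fun h ↦ hx (hs h)

theorem geomFace_subset_geomRealOn {C : Set X} (hC : IsChain (· ≤ ·) C) (hCS : C ⊆ S) :
    geomFace C ⊆ geomRealOn S := fun _ hf ↦
  ⟨hf.1, hf.2.1.trans hCS, hC.mono hf.2.1, Finset.univ, by simp, hf.2.2⟩

open Classical in
/-- A vertex of the geometric realization. -/
noncomputable def geomVertex (x : X) (hx : x ∈ S) : geomRealOn S :=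
  ⟨Pi.single x 1, geomFace_subset_geomRealOn (C := {x}) (by simp) (by simpa)
    (single_mem_geomFace rfl)⟩

theorem geomVertex_mem_geomFace {x : X} (hx : x ∈ S) {C : Set X} (h : x ∈ C) :
    (geomVertex x hx : X → ℝ) ∈ geomFace C := by
  classical
  unfold geomVertex
  convert single_mem_geomFace (C := C) h

/-- The edge of the geometric realization joining two comparable vertices. -/
noncomputable def geomEdge {x y : X} (h : AdjIn S x y) :
    Path (geomVertex x h.1) (geomVertex y h.2.1) :=
  segmentPath (convex_geomFace {x, y}) (geomFace_subset_geomRealOn h.isChain h.subset)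
    (geomVertex_mem_geomFace _ (by simp)) (geomVertex_mem_geomFace _ (by simp))

theorem geomEdge_trans_homotopic {x y z : X} (hxy : AdjIn S x y) (hyz : AdjIn S y z)
    (hxz : AdjIn S x z) :
    ((geomEdge hxy).trans (geomEdge hyz)).Homotopic (geomEdge hxz) := by
  have hC : IsChain (· ≤ ·) ({x, y, z} : Set X) := by
    rintro a (rfl | rfl | rfl) b (rfl | rfl | rfl) hab <;>
      first
      | exact absurd rfl hab
      | exact hxy.2.2 | exact hyz.2.2 | exact hxz.2.2
      | exact hxy.2.2.symm | exact hyz.2.2.symm | exact hxz.2.2.symm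
  have hCS : ({x, y, z} : Set X) ⊆ S := by
    rintro a (rfl | rfl | rfl)
    exacts [hxy.1, hxy.2.1, hyz.2.1]
  have mono : ∀ {a b : X} (h : AdjIn S a b), a ∈ ({x, y, z} : Set X) → b ∈ ({x, y, z} : Set X) →
      ∀ t, (geomEdge h t : X → ℝ) ∈ geomFace {x, y, z} := fun h ha hb t ↦
    segmentPath_mem (convex_geomFace _) (geomFace_subset_geomRealOn hC hCS)
      (geomVertex_mem_geomFace _ ha) (geomVertex_mem_geomFace _ hb) t
  refine Path.homotopic_of_mem_convex (convex_geomFace {x, y, z})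
    (geomFace_subset_geomRealOn hC hCS) _ _ (fun t ↦ ?_) (mono hxz (by simp) (by simp))
  rw [Path.trans_apply]
  split_ifs
  · exact mono hxy (by simp) (by simp) _
  · exact mono hyz (by simp) (by simp) _

theorem joined_geomVertex {x : X} (f : geomRealOn S) (hx : (f : X → ℝ) x ≠ 0) :
    Joined f (geomVertex x (f.2.2.1 hx)) :=
  ⟨segmentPath (convex_geomFace (support (f : X → ℝ)))
    (geomFace_subset_geomRealOn f.2.2.2.1 f.2.2.1)
    ⟨f.2.1, subset_rfl, sum_eq_one_of_mem_geomRealOn f.2⟩ (geomVertex_mem_geomFace _ hx)⟩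

theorem exists_apply_ne_zero (f : geomRealOn S) : ∃ x, (f : X → ℝ) x ≠ 0 := by
  by_contra! h
  simpa [h] using sum_eq_one_of_mem_geomRealOn f.2

theorem pathConnectedSpace_geomRealOn (hS : S.Nonempty)
    (h : ∀ x ∈ S, ∀ y ∈ S, Relation.ReflTransGen (AdjIn S) x y) :
    PathConnectedSpace (geomRealOn S) := by
  have key : ∀ {x y : X} (hx : x ∈ S), Relation.ReflTransGen (AdjIn S) x y →
      ∃ hy : y ∈ S, Joined (geomVertex x hx) (geomVertex y hy) := fun hx hxy ↦ by
    induction hxy with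
    | refl => exact ⟨hx, .refl _⟩
    | tail _ hbc ih =>
      obtain ⟨_, ih⟩ := ih
      exact ⟨hbc.2.1, ih.trans ⟨geomEdge hbc⟩⟩
  refine ⟨⟨geomVertex _ hS.some_mem⟩, fun f g ↦ ?_⟩
  obtain ⟨x, hx⟩ := exists_apply_ne_zero f
  obtain ⟨y, hy⟩ := exists_apply_ne_zero g
  obtain ⟨_, hxy⟩ := key (f.2.2.1 hx) (h x (f.2.2.1 hx) y (g.2.2.1 hy))
  exact (joined_geomVertex f hx).trans (hxy.trans (joined_geomVertex g hy).symm)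

/-- An integral 1-cocycle on the order complex of `S`. -/
def IsOneCocycle (S : Set X) (d : X → X → ℤ) : Prop :=
  ∀ x y z, AdjIn S x y → AdjIn S y z → AdjIn S x z → d x y + d y z = d x z

/-- A real lift of the circle-valued map of a cocycle, relative to a reference vertex `x`. -/
def cocycleLift (d : X → X → ℤ) (x : X) (f : X → ℝ) : ℝ := ∑ y, f y * d x y

theorem coe_cocycleLift_eq {d : X → X → ℤ} (hd : IsOneCocycle S d) (f : geomRealOn S) {x y : X}
    (hxy : AdjIn S x y) (hx : ∀ z, (f : X → ℝ) z ≠ 0 → AdjIn S x z)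
    (hy : ∀ z, (f : X → ℝ) z ≠ 0 → AdjIn S y z) :
    ((cocycleLift d x f : ℝ) : AddCircle (1 : ℝ)) = (cocycleLift d y f : ℝ) := by
  have : cocycleLift d x f = d x y + cocycleLift d y f := by
    rw [← mul_one (d x y : ℝ), ← sum_eq_one_of_mem_geomRealOn f.2, Finset.mul_sum, cocycleLift,
      cocycleLift, ← Finset.sum_add_distrib]
    refine Finset.sum_congr rfl fun z _ ↦ ?_
    by_cases hz : (f : X → ℝ) z = 0
    · simp [hz]
    · rw [← hd x y z hxy (hy z hz) (hx z hz)]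
      push_cast
      ring
  rw [this, AddCircle.coe_add]
  simp

/-- The circle-valued map on the geometric realization defined by an integral 1-cocycle. -/
noncomputable def cocycleMap (d : X → X → ℤ) (hd : IsOneCocycle S d) :
    C(geomRealOn S, AddCircle (1 : ℝ)) where
  toFun f := (cocycleLift d (exists_apply_ne_zero f).choose f : ℝ)
  continuous_toFun := by
    refine continuous_iff_continuousAt.2 fun f ↦ ?_
    obtain ⟨x, hx⟩ := exists_apply_ne_zero f
    have hopen : {g : geomRealOn S | (g : X → ℝ) x ≠ 0} ∈ 𝓝 f :=
      (isOpen_ne.preimage ((continuous_apply x).comp continuous_subtype_val)).mem_nhds hx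
    have hcont : Continuous fun g : geomRealOn S ↦
        ((cocycleLift d x g : ℝ) : AddCircle (1 : ℝ)) := by
      unfold cocycleLift
      refine (AddCircle.isCoveringMap_coe (1 : ℝ)).continuous.comp ?_
      exact continuous_finsetSum _ fun y _ ↦
        ((continuous_apply y).comp continuous_subtype_val).mul continuous_const
    refine hcont.continuousAt.congr ?_
    filter_upwards [hopen] with g hg
    have hc := (exists_apply_ne_zero g).choose_spec
    exact coe_cocycleLift_eq hd g (adjIn_of_apply_ne_zero g hg hc)
      (fun z hz ↦ adjIn_of_apply_ne_zero g hg hz) (fun z hz ↦ adjIn_of_apply_ne_zero g hc hz)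

theorem cocycleMap_apply {d : X → X → ℤ} (hd : IsOneCocycle S d) (f : geomRealOn S) {x : X}
    (hx : ∀ z, (f : X → ℝ) z ≠ 0 → AdjIn S x z) :
    cocycleMap d hd f = (cocycleLift d x f : ℝ) := by
  have hc := (exists_apply_ne_zero f).choose_spec
  exact coe_cocycleLift_eq hd f (hx _ hc).symm
    (fun z hz ↦ adjIn_of_apply_ne_zero f hc hz) hx

theorem displacement_geomEdge {d : X → X → ℤ} (hd : IsOneCocycle S d) {x y : X}
    (h : AdjIn S x y) : displacement (cocycleMap d hd) (.mk (geomEdge h)) = d x y := by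
  classical
  have hval : ∀ t : I, cocycleLift d x (geomEdge h t) = (1 - (t : ℝ)) * d x x + t * d x y := by
    intro t
    have : (geomEdge h t : X → ℝ) = (1 - (t : ℝ)) • Pi.single x 1 + (t : ℝ) • Pi.single y 1 := by
      rw [geomEdge, segmentPath_apply]
      congr!
    simp [this, cocycleLift, add_mul, Finset.sum_add_distrib, Pi.single_apply]
  have hxx : AdjIn S x x := ⟨h.1, h.1, .inl le_rfl⟩
  rw [displacement_mk_eq_of_lift (cocycleMap d hd) (geomEdge h)
    ⟨fun t : I ↦ (1 - (t : ℝ)) * d x x + t * d x y, by fun_prop⟩]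
  · have : d x x = 0 := by simpa using hd x x x hxx hxx hxx
    simp [this]
  · intro t
    rw [cocycleMap_apply hd (geomEdge h t) (x := x), hval]
    · rfl
    · intro z hz
      have : z ∈ ({x, y} : Set X) := (segmentPath_mem (convex_geomFace {x, y})
        (geomFace_subset_geomRealOn h.isChain h.subset)
        (geomVertex_mem_geomFace h.1 (by simp)) (geomVertex_mem_geomFace h.2.1 (by simp)) t).2.1 hz
      rcases this with rfl | rfl
      exacts [hxx, h]

/-- Transport of edges of the order complex to the fundamental group along a choice of paths from
the base point to the vertices. -/
theorem exists_edge_labelling [PathConnectedSpace (geomRealOn S)] (p : geomRealOn S) :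
    ∃ g : X → X → FundamentalGroup (geomRealOn S) p,
      (∀ x y z, AdjIn S x y → AdjIn S y z → AdjIn S x z → g x y * g y z = g x z) ∧
      ∀ d : X → X → ℤ, IsOneCocycle S d →
        ∃ (W : FundamentalGroup (geomRealOn S) p →* Multiplicative ℝ) (q : X → ℝ),
          ∀ x y, AdjIn S x y → (W (g x y)).toAdd = d y x + q y - q x := by
  classical
  let P (x : X) (hx : x ∈ S) : Path.Homotopic.Quotient p (geomVertex x hx) :=
    .mk (PathConnectedSpace.somePath _ _)
  let g (x y : X) : FundamentalGroup (geomRealOn S) p :=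
    if h : AdjIn S x y then
      FundamentalGroup.fromPath
        (((P y h.2.1).trans (.mk (geomEdge h.symm))).trans (P x h.1).symm)
    else 1
  refine ⟨g, fun x y z hxy hyz hxz ↦ ?_, fun d hd ↦ ⟨displacementHom (cocycleMap d hd) p,
    fun x ↦ if hx : x ∈ S then displacement (cocycleMap d hd) (P x hx) else 0, fun x y h ↦ ?_⟩⟩
  · have hh := Path.Homotopic.Quotient.eq.2 (geomEdge_trans_homotopic hyz.symm hxy.symm hxz.symm)
    simp only [g, dif_pos hxy, dif_pos hyz, dif_pos hxz, FundamentalGroup.mul_def, ← hh,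
      Path.Homotopic.Quotient.mk_trans]
    exact Path.Homotopic.Quotient.trans_conj_trans _ _ _ _ _
  · simp only [g, dif_pos h, dif_pos h.1, dif_pos h.2.1]
    change displacement (cocycleMap d hd) (((P y h.2.1).trans (.mk (geomEdge h.symm))).trans
      (P x h.1).symm) = _
    rw [displacement_trans, displacement_trans, displacement_symm, displacement_geomEdge]
    ring

end OrderComplex

/-- Commuting elements of a free group have linearly dependent images under any two
homomorphisms to `ℝ`. -/
theorem FreeGroup.mul_toAdd_eq_of_commute {S : Type*} {a b : FreeGroup S} (hab : Commute a b)
    (f g : FreeGroup S →* Multiplicative ℝ) :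
    (f a).toAdd * (g b).toAdd = (f b).toAdd * (g a).toAdd := by
  let H := Subgroup.closure ({a, b} : Set (FreeGroup S))
  have hcomm : ∀ x y : H, x * y = y * x := by
    have : IsMulCommutative H := Subgroup.isMulCommutative_closure (by
      rintro x (rfl | rfl) y (rfl | rfl)
      exacts [rfl, hab, hab.symm, rfl])
    exact fun x y ↦ mul_comm' x y
  have hsub : Subsingleton (IsFreeGroup.Generators H) := by
    refine ⟨fun s t ↦ ?_⟩
    by_contra hst
    classical
    let φ : H →* Equiv.Perm (Fin 3) := IsFreeGroup.lift fun u ↦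
      if u = s then Equiv.swap 0 1 else Equiv.swap 1 2
    have hs : φ (IsFreeGroup.of s) = Equiv.swap 0 1 := by
      rw [IsFreeGroup.lift_of, if_pos rfl]
    have ht : φ (IsFreeGroup.of t) = Equiv.swap 1 2 := by
      rw [IsFreeGroup.lift_of, if_neg (Ne.symm hst)]
    have := congr_arg φ (hcomm (IsFreeGroup.of s) (IsFreeGroup.of t))
    rw [_root_.map_mul, _root_.map_mul, hs, ht] at this
    revert this
    decide
  let w : H →* Multiplicative ℝ := IsFreeGroup.lift fun _ ↦ .ofAdd 1
  have hprop : ∀ f : H →* Multiplicative ℝ, ∃ c : ℝ, ∀ x, (f x).toAdd = c * (w x).toAdd := by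
    intro f
    obtain ⟨c, hc⟩ : ∃ c : ℝ, ∀ s, f (IsFreeGroup.of s) = .ofAdd c := by
      rcases isEmpty_or_nonempty (IsFreeGroup.Generators H) with h | ⟨⟨s⟩⟩
      · exact ⟨0, fun s ↦ (h.false s).elim⟩
      · exact ⟨(f (IsFreeGroup.of s)).toAdd, fun t ↦ by rw [Subsingleton.elim t s]; rfl⟩
    have : f = (AddMonoidHom.mulLeft c).toMultiplicative.comp w := IsFreeGroup.ext_hom fun s ↦ by
      rw [hc, MonoidHom.comp_apply, IsFreeGroup.lift_of]
      simp
    exact ⟨c, fun x ↦ congr_arg Multiplicative.toAdd congr($this x)⟩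
  obtain ⟨c, hc⟩ := hprop (f.comp H.subtype)
  obtain ⟨d, hd⟩ := hprop (g.comp H.subtype)
  let a' : H := ⟨a, Subgroup.subset_closure (by simp)⟩
  let b' : H := ⟨b, Subgroup.subset_closure (by simp)⟩
  have hfa : (f a).toAdd = c * (w a').toAdd := hc a'
  have hfb : (f b).toAdd = c * (w b').toAdd := hc b'
  have hga : (g a).toAdd = d * (w a').toAdd := hd a'
  have hgb : (g b).toAdd = d * (w b').toAdd := hd b'
  rw [hfa, hfb, hga, hgb]
  ring

/-- Two vertices of the chessboard complex on `4 × 3` squares are adjacent if they lie in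
different rows and columns. -/
def NonAttacking (u v : Fin 4 × Fin 3) : Prop := u.1 ≠ v.1 ∧ u.2 ≠ v.2

section Chessboard

variable {G : Type*} [Group G]

/-- A labelling of the oriented edges of the `4 × 3` chessboard complex which is compatible with
its triangles (possibly degenerate). -/
structure IsChessboardLabelling (e : Fin 4 × Fin 3 → Fin 4 × Fin 3 → G) : Prop where
  mul_symm : ∀ u v, NonAttacking u v → e u v * e v u = 1
  mul_mul : ∀ u v w, NonAttacking u v → NonAttacking v w → NonAttacking u w →
    e u v * e v w = e u w

/-- The label of a closed walk of length four. -/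
def squareLabel (e : Fin 4 × Fin 3 → Fin 4 × Fin 3 → G) (a b c d : Fin 4 × Fin 3) : G :=
  e a b * e b c * e c d * e d a

theorem IsChessboardLabelling.squareLabel_eq {e : Fin 4 × Fin 3 → Fin 4 × Fin 3 → G}
    (he : IsChessboardLabelling e) {x x' y y' : Fin 4} {j k l : Fin 3}
    (hx : [x, x', y, y'].Nodup) (hj : [j, k, l].Nodup) :
    squareLabel e (x, j) (y, k) (x', j) (y', k) =
      e (x, j) (x', k) * squareLabel e (x', k) (y', l) (x, k) (y, l) * e (x', k) (x, j) := by
  simp only [List.nodup_cons, List.mem_cons, not_or, List.not_mem_nil, not_false_eq_true,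
    and_true, List.nodup_nil] at hx hj
  obtain ⟨⟨h1, h2, h3⟩, ⟨h4, h5⟩, h6⟩ := hx
  obtain ⟨⟨h7, h8⟩, h9⟩ := hj
  have slide : ∀ a b b' c : Fin 4 × Fin 3, NonAttacking a b → NonAttacking b c →
      NonAttacking a b' → NonAttacking b' c → NonAttacking b b' →
      e a b * e b c = e a b' * e b' c := fun a b b' c hab hbc hab' hbc' hbb' ↦ by
    rw [← he.mul_mul a b' b hab' ⟨hbb'.1.symm, hbb'.2.symm⟩ hab, mul_assoc,
      he.mul_mul b' b c ⟨hbb'.1.symm, hbb'.2.symm⟩ hbc hbc']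
  have e1 := slide (x, j) (y, k) (y', l) (x', j) (by constructor <;> grind)
    (by constructor <;> grind) (by constructor <;> grind) (by constructor <;> grind)
    (by constructor <;> grind)
  have e2 := slide (x', j) (y', k) (y, l) (x, j) (by constructor <;> grind)
    (by constructor <;> grind) (by constructor <;> grind) (by constructor <;> grind)
    (by constructor <;> grind)
  have e3 := slide (y', l) (x', j) (x, k) (y, l) (by constructor <;> grind)
    (by constructor <;> grind) (by constructor <;> grind) (by constructor <;> grind)
    (by constructor <;> grind)
  have e4 := he.mul_mul (x, j) (x', k) (y', l) (by constructor <;> grind)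
    (by constructor <;> grind) (by constructor <;> grind)
  have e5 := he.mul_mul (y, l) (x', k) (x, j) (by constructor <;> grind)
    (by constructor <;> grind) (by constructor <;> grind)
  calc
    _ = (e (x, j) (y, k) * e (y, k) (x', j)) * (e (x', j) (y', k) * e (y', k) (x, j)) := by
      simp only [squareLabel, mul_assoc]
    _ = e (x, j) (y', l) * (e (y', l) (x', j) * e (x', j) (y, l)) * e (y, l) (x, j) := by
      simp only [e1, e2, mul_assoc]
    _ = _ := by
      simp only [e3, ← e4, ← e5, squareLabel, mul_assoc]

/-- The label of a closed walk of length six in the first two rows. -/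
def hexagonLabel (e : Fin 4 × Fin 3 → Fin 4 × Fin 3 → G) : G :=
  e (0, 0) (1, 1) * e (1, 1) (0, 2) * e (0, 2) (1, 0) * e (1, 0) (0, 1) * e (0, 1) (1, 2) *
    e (1, 2) (0, 0)

theorem IsChessboardLabelling.commute {e : Fin 4 × Fin 3 → Fin 4 × Fin 3 → G}
    (he : IsChessboardLabelling e) :
    Commute (squareLabel e (0, 0) (2, 1) (1, 0) (3, 1)) (hexagonLabel e) := by
  have h1 := he.squareLabel_eq (x := 0) (x' := 1) (y := 2) (y' := 3) (j := 0) (k := 1) (l := 2)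
    (by decide) (by decide)
  have h2 := he.squareLabel_eq (x := 1) (x' := 0) (y := 3) (y' := 2) (j := 1) (k := 2) (l := 0)
    (by decide) (by decide)
  have h3 := he.squareLabel_eq (x := 0) (x' := 1) (y := 2) (y' := 3) (j := 2) (k := 0) (l := 1)
    (by decide) (by decide)
  have h4 := he.squareLabel_eq (x := 1) (x' := 0) (y := 3) (y' := 2) (j := 0) (k := 1) (l := 2)
    (by decide) (by decide)
  have h5 := he.squareLabel_eq (x := 0) (x' := 1) (y := 2) (y' := 3) (j := 1) (k := 2) (l := 0)
    (by decide) (by decide)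
  have h6 := he.squareLabel_eq (x := 1) (x' := 0) (y := 3) (y' := 2) (j := 2) (k := 0) (l := 1)
    (by decide) (by decide)
  have inv : ∀ u v, NonAttacking u v → e v u = (e u v)⁻¹ := fun u v h ↦
    (inv_eq_of_mul_eq_one_right (he.mul_symm u v h)).symm
  rw [inv (0, 0) (1, 1) (by constructor <;> decide)] at h1
  rw [inv (1, 1) (0, 2) (by constructor <;> decide)] at h2
  rw [inv (0, 2) (1, 0) (by constructor <;> decide)] at h3
  rw [inv (1, 0) (0, 1) (by constructor <;> decide)] at h4
  rw [inv (0, 1) (1, 2) (by constructor <;> decide)] at h5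
  rw [inv (1, 2) (0, 0) (by constructor <;> decide)] at h6
  rw [h2, h3, h4, h5, h6] at h1
  have key : squareLabel e (0, 0) (2, 1) (1, 0) (3, 1) =
      hexagonLabel e * squareLabel e (0, 0) (2, 1) (1, 0) (3, 1) * (hexagonLabel e)⁻¹ := by
    conv_lhs => rw [h1]
    simp only [hexagonLabel, mul_inv_rev, mul_assoc]
  exact eq_mul_inv_iff_mul_eq.1 key

/-- The basic antisymmetric function from which the cocycles are built: it detects the step from
`1` to `2`. -/
def stepOneTwo (m n : ℕ) : ℤ :=
  if m = 1 ∧ n = 2 then 1 else if m = 2 ∧ n = 1 then -1 else 0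

/-- The number of elements of a five-element test set in the triple labelled by a square of the
chessboard, where the test set meets the row labels in `R`. -/
def rowCount (R : Finset (Fin 4)) (u : Fin 4 × Fin 3) : ℕ :=
  (if u.1 ∈ R then 1 else 0) + (2 - u.2)

theorem IsChessboardLabelling.not_mulEquiv_freeGroup {e : Fin 4 × Fin 3 → Fin 4 × Fin 3 → G}
    (he : IsChessboardLabelling e)
    (hW : ∀ R : Finset (Fin 4), R.card = 2 →
      ∃ (W : G →* Multiplicative ℝ) (q : Fin 4 × Fin 3 → ℝ), ∀ u v, NonAttacking u v →
        (W (e u v)).toAdd = stepOneTwo (rowCount R v) (rowCount R u) + q v - q u)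
    (S : Type*) (φ : G ≃* FreeGroup S) : False := by
  obtain ⟨W₁, q₁, h₁⟩ := hW {0, 2} rfl
  obtain ⟨W₂, q₂, h₂⟩ := hW {0, 1} rfl
  have key := FreeGroup.mul_toAdd_eq_of_commute (he.commute.map φ)
    (W₁.comp φ.symm.toMonoidHom) (W₂.comp φ.symm.toMonoidHom)
  simp only [MonoidHom.comp_apply, MulEquiv.toMonoidHom_eq_coe, MonoidHom.coe_coe,
    MulEquiv.symm_apply_apply] at key
  have square : ∀ (R : Finset (Fin 4)) (W : G →* Multiplicative ℝ) (q : Fin 4 × Fin 3 → ℝ),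
      (∀ u v, NonAttacking u v →
        (W (e u v)).toAdd = stepOneTwo (rowCount R v) (rowCount R u) + q v - q u) →
      (W (squareLabel e (0, 0) (2, 1) (1, 0) (3, 1))).toAdd =
        ((stepOneTwo (rowCount R (2, 1)) (rowCount R (0, 0)) +
        stepOneTwo (rowCount R (1, 0)) (rowCount R (2, 1)) +
        stepOneTwo (rowCount R (3, 1)) (rowCount R (1, 0)) +
        stepOneTwo (rowCount R (0, 0)) (rowCount R (3, 1)) : ℤ) : ℝ) := by
    intro R W q h
    simp only [squareLabel, map_mul, toAdd_mul]
    rw [h _ _ (by constructor <;> decide), h _ _ (by constructor <;> decide),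
      h _ _ (by constructor <;> decide), h _ _ (by constructor <;> decide)]
    push_cast
    ring
  have hexagon : ∀ (R : Finset (Fin 4)) (W : G →* Multiplicative ℝ) (q : Fin 4 × Fin 3 → ℝ),
      (∀ u v, NonAttacking u v →
        (W (e u v)).toAdd = stepOneTwo (rowCount R v) (rowCount R u) + q v - q u) →
      (W (hexagonLabel e)).toAdd =
        ((stepOneTwo (rowCount R (1, 1)) (rowCount R (0, 0)) +
        stepOneTwo (rowCount R (0, 2)) (rowCount R (1, 1)) +
        stepOneTwo (rowCount R (1, 0)) (rowCount R (0, 2)) +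
        stepOneTwo (rowCount R (0, 1)) (rowCount R (1, 0)) +
        stepOneTwo (rowCount R (1, 2)) (rowCount R (0, 1)) +
        stepOneTwo (rowCount R (0, 0)) (rowCount R (1, 2)) : ℤ) : ℝ) := by
    intro R W q h
    simp only [hexagonLabel, map_mul, toAdd_mul]
    rw [h _ _ (by constructor <;> decide), h _ _ (by constructor <;> decide),
      h _ _ (by constructor <;> decide), h _ _ (by constructor <;> decide),
      h _ _ (by constructor <;> decide), h _ _ (by constructor <;> decide)]
    push_cast
    ring
  rw [square _ _ _ h₁, square _ _ _ h₂, hexagon _ _ _ h₁, hexagon _ _ _ h₂] at key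
  revert key
  norm_cast

end Chessboard

section AltTen

/-- The alternating group on ten letters. -/
abbrev AltTen : Subgroup (Equiv.Perm (Fin 10)) := alternatingGroup (Fin 10)

theorem closure_mem_apSet {p : ℕ} {G : Type*} [Group G] {s : Set G} (hs : ∃ g ∈ s, g ≠ 1)
    (hcomm : ∀ g ∈ s, ∀ h ∈ s, g * h = h * g) (hpow : ∀ g ∈ s, g ^ p = 1) :
    Subgroup.closure s ∈ apSet p G := by
  have hc : ∀ a b : Subgroup.closure s, a * b = b * a := by
    have : IsMulCommutative (Subgroup.closure s) := Subgroup.isMulCommutative_closure hcomm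
    exact fun x y ↦ mul_comm' x y
  refine ⟨fun h ↦ ?_, hc, fun a ↦ ?_⟩
  · obtain ⟨g, hg, hg1⟩ := hs
    exact hg1 (Subgroup.mem_bot.1 (h ▸ Subgroup.subset_closure hg))
  · obtain ⟨a, ha⟩ := a
    rw [Subtype.ext_iff]
    change a ^ p = 1
    induction ha using Subgroup.closure_induction with
    | mem x hx => exact hpow x hx
    | one => simp
    | mul x y hx hy ihx ihy =>
      have : Commute x y := congr_arg Subtype.val (hc ⟨x, hx⟩ ⟨y, hy⟩)
      rw [this.mul_pow, ihx, ihy, one_mul]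
    | inv x _ ih => rw [inv_pow, ih, inv_one]

theorem exists_isThreeCycle_reachable {H : Subgroup AltTen} (hH : H ∈ apSet 3 AltTen) :
    ∃ t : AltTen, (t : Equiv.Perm (Fin 10)).IsThreeCycle ∧
      Relation.ReflTransGen (AdjIn (apSet 3 AltTen)) H (Subgroup.closure {t}) := by
  obtain ⟨h, hhH, h1⟩ := H.ne_bot_iff_exists_ne_one.1 hH.1 |>.elim
    fun a ha ↦ (⟨a.1, a.2, fun h ↦ ha (Subtype.ext h)⟩ : ∃ h ∈ H, h ≠ 1)
  have h3 : h ^ 3 = 1 := congr_arg Subtype.val (hH.2.2 ⟨h, hhH⟩)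
  obtain ⟨x, hx⟩ : ∃ x, (h : Equiv.Perm (Fin 10)) x ≠ x := by
    by_contra! hc
    exact h1 (Subtype.ext (Equiv.ext hc))
  let t := (h : Equiv.Perm (Fin 10)).cycleOf x
  have htc : t.IsCycle := Equiv.Perm.isCycle_cycleOf _ hx
  have hord : orderOf t ∣ 3 := by
    refine (Equiv.Perm.orderOf_cycleOf_dvd_orderOf _ x).trans (orderOf_dvd_of_pow_eq_one ?_)
    exact congr_arg Subtype.val h3
  have ht3 : t.IsThreeCycle := by
    rw [← card_support_eq_three_iff, ← htc.orderOf]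
    refine ((Nat.dvd_prime Nat.prime_three).1 hord).resolve_left fun h ↦ ?_
    exact htc.ne_one (orderOf_eq_one_iff.1 h)
  let t' : AltTen := ⟨t, ht3.mem_alternatingGroup⟩
  have hcomm : h * t' = t' * h := by
    refine Subtype.ext (Equiv.ext fun y ↦ ?_)
    simp only [Subgroup.coe_mul, Equiv.Perm.mul_apply, t', t, Equiv.Perm.cycleOf_apply,
      Equiv.Perm.sameCycle_apply_right]
    split_ifs <;> rfl
  have ht'3 : t' ^ 3 = 1 := Subtype.ext (orderOf_dvd_iff_pow_eq_one.1 hord)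
  have ht'1 : t' ≠ 1 := fun h ↦ htc.ne_one (congr_arg Subtype.val h)
  have m1 : Subgroup.closure {h} ∈ apSet 3 AltTen := closure_mem_apSet ⟨h, rfl, h1⟩
    (by rintro _ rfl _ rfl; rfl) (by rintro _ rfl; exact h3)
  have m2 : Subgroup.closure {t'} ∈ apSet 3 AltTen := closure_mem_apSet ⟨t', rfl, ht'1⟩
    (by rintro _ rfl _ rfl; rfl) (by rintro _ rfl; exact ht'3)
  have m3 : Subgroup.closure {h, t'} ∈ apSet 3 AltTen := closure_mem_apSet ⟨h, by simp, h1⟩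
    (by rintro _ (rfl | rfl) _ (rfl | rfl) <;> first | rfl | exact hcomm | exact hcomm.symm)
    (by rintro _ (rfl | rfl) <;> assumption)
  refine ⟨t', ht3, .tail (.tail (.single ⟨hH, m1, .inr ?_⟩)
    ⟨m1, m3, .inl (Subgroup.closure_mono (by simp))⟩)
    ⟨m3, m2, .inr (Subgroup.closure_mono (by simp))⟩⟩
  simpa using hhH

theorem reachable_of_commute {s t : AltTen} (hs : (s : Equiv.Perm (Fin 10)).IsThreeCycle)
    (ht : (t : Equiv.Perm (Fin 10)).IsThreeCycle) (hst : s * t = t * s) :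
    Relation.ReflTransGen (AdjIn (apSet 3 AltTen)) (Subgroup.closure {s})
      (Subgroup.closure {t}) := by
  have h3 : ∀ {s : AltTen}, (s : Equiv.Perm (Fin 10)).IsThreeCycle → s ^ 3 = 1 := fun hs ↦
    Subtype.ext (orderOf_dvd_iff_pow_eq_one.1 hs.orderOf.dvd)
  have h1 : ∀ {s : AltTen}, (s : Equiv.Perm (Fin 10)).IsThreeCycle → s ≠ 1 := fun hs h ↦
    hs.isCycle.ne_one (congr_arg Subtype.val h)
  have mem : ∀ {s : AltTen}, (s : Equiv.Perm (Fin 10)).IsThreeCycle →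
      Subgroup.closure {s} ∈ apSet 3 AltTen := fun hs ↦ closure_mem_apSet ⟨_, rfl, h1 hs⟩
    (by rintro _ rfl _ rfl; rfl) (by rintro _ rfl; exact h3 hs)
  have mem' : Subgroup.closure {s, t} ∈ apSet 3 AltTen := closure_mem_apSet ⟨s, by simp, h1 hs⟩
    (by rintro _ (rfl | rfl) _ (rfl | rfl) <;> first | rfl | exact hst | exact hst.symm)
    (by rintro _ (rfl | rfl) <;> exact h3 ‹_›)
  exact .tail (.single ⟨mem hs, mem', .inl (Subgroup.closure_mono (by simp))⟩)
    ⟨mem', mem ht, .inr (Subgroup.closure_mono (by simp))⟩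

theorem reachable_of_isThreeCycle {s t : AltTen} (hs : (s : Equiv.Perm (Fin 10)).IsThreeCycle)
    (ht : (t : Equiv.Perm (Fin 10)).IsThreeCycle) :
    Relation.ReflTransGen (AdjIn (apSet 3 AltTen)) (Subgroup.closure {s})
      (Subgroup.closure {t}) := by
  obtain ⟨B, hB, hB3⟩ : ∃ B ⊆ ((s : Equiv.Perm (Fin 10)).support ∪
      (t : Equiv.Perm (Fin 10)).support)ᶜ, B.card = 3 := by
    refine Finset.exists_subset_card_eq ?_
    have := Finset.card_union_le (s : Equiv.Perm (Fin 10)).support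
      (t : Equiv.Perm (Fin 10)).support
    rw [hs.card_support, ht.card_support] at this
    rw [Finset.card_compl, Fintype.card_fin]
    omega
  obtain ⟨a, b, c, hab, hac, hbc, rfl⟩ := Finset.card_eq_three.1 hB3
  have hw := Equiv.Perm.isThreeCycle_swap_mul_swap_same hab hac hbc
  have hsupp : (Equiv.swap a b * Equiv.swap a c).support ⊆ {a, b, c} := by
    refine (Equiv.Perm.support_mul_le _ _).trans ?_
    simp only [Equiv.Perm.support_swap hab, Equiv.Perm.support_swap hac]
    intro x
    simp
  let w : AltTen := ⟨_, hw.mem_alternatingGroup⟩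
  have hdisj := Finset.disjoint_of_subset_right (hsupp.trans hB) disjoint_compl_right
  rw [Finset.disjoint_union_left] at hdisj
  have hsw : s * w = w * s :=
    Subtype.ext (Equiv.Perm.disjoint_iff_disjoint_support.2 hdisj.1).commute
  have htw : t * w = w * t :=
    Subtype.ext (Equiv.Perm.disjoint_iff_disjoint_support.2 hdisj.2).commute
  exact (reachable_of_commute hs hw hsw).trans (reachable_of_commute hw ht htw.symm)

theorem AdjIn.reflTransGen_symm {X : Type*} [PartialOrder X] {S : Set X} {x y : X}
    (h : Relation.ReflTransGen (AdjIn S) x y) : Relation.ReflTransGen (AdjIn S) y x :=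
  have : Std.Symm (AdjIn S) := ⟨fun _ _ h ↦ h.symm⟩
  Relation.ReflTransGen.stdSymm.symm _ _ h

theorem pathConnectedSpace_geomRealOn_apSet :
    PathConnectedSpace (geomRealOn (apSet 3 AltTen)) := by
  have : Fintype (Subgroup AltTen) := Fintype.ofFinite _
  refine pathConnectedSpace_geomRealOn ?_ fun H hH K hK ↦ ?_
  · have h : (Equiv.swap (0 : Fin 10) 1 * Equiv.swap 0 2).IsThreeCycle :=
      Equiv.Perm.isThreeCycle_swap_mul_swap_same (by decide) (by decide) (by decide)
    let s : AltTen := ⟨_, h.mem_alternatingGroup⟩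
    exact ⟨Subgroup.closure {s}, closure_mem_apSet
      ⟨s, rfl, fun hs ↦ h.isCycle.ne_one (congr_arg Subtype.val hs)⟩
      (by rintro _ rfl _ rfl; rfl)
      (by rintro _ rfl; exact Subtype.ext (orderOf_dvd_iff_pow_eq_one.1 h.orderOf.dvd))⟩
  · obtain ⟨s, hs, hHs⟩ := exists_isThreeCycle_reachable hH
    obtain ⟨t, ht, hKt⟩ := exists_isThreeCycle_reachable hK
    exact hHs.trans ((reachable_of_isThreeCycle hs ht).trans (AdjIn.reflTransGen_symm hKt))

section OrbitCocycle

open MulAction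

theorem card_orbit_of_mem_apSet {H : Subgroup AltTen} (hH : H ∈ apSet 3 AltTen) (x : Fin 10) :
    (orbit H x).ncard = 1 ∨ (orbit H x).ncard = 3 ∨ (orbit H x).ncard = 9 := by
  have : Fact (Nat.Prime 3) := ⟨Nat.prime_three⟩
  have hp : IsPGroup 3 H := fun a ↦ ⟨1, by simpa using hH.2.2 a⟩
  obtain ⟨n, hn⟩ := hp.card_orbit x
  rw [Nat.card_coe_set_eq] at hn
  have hle : (orbit H x).ncard ≤ 10 := by simpa using Set.ncard_le_card (orbit H x)
  have : n < 3 := by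
    by_contra! h
    have := Nat.pow_le_pow_right (n := 3) (by norm_num) h
    omega
  interval_cases n <;> simp_all

theorem orbit_subset_orbit_of_le {H K : Subgroup AltTen} (h : H ≤ K) (x : Fin 10) :
    orbit H x ⊆ orbit K x := by
  rintro _ ⟨g, rfl⟩
  exact ⟨⟨g, h g.2⟩, rfl⟩

/-- Some orbit of `H` has more than three points. -/
def HasLargeOrbit (H : Subgroup AltTen) : Prop := ∃ x : Fin 10, 3 < (orbit H x).ncard

theorem HasLargeOrbit.mono {H K : Subgroup AltTen} (h : H ≤ K) :
    HasLargeOrbit H → HasLargeOrbit K := fun ⟨x, hx⟩ ↦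
  ⟨x, hx.trans_le (Set.ncard_le_ncard (orbit_subset_orbit_of_le h x) (Set.toFinite _))⟩

theorem HasLargeOrbit.card_eq {L : Subgroup AltTen} (hL : L ∈ apSet 3 AltTen)
    (h : HasLargeOrbit L) : Nat.card L = 9 := by
  obtain ⟨x, hx⟩ := h
  have hx9 : (orbit L x).ncard = 9 := by
    rcases card_orbit_of_mem_apSet hL x with h | h | h <;> omega
  have hstab : stabilizer L x = ⊥ := by
    rw [eq_bot_iff]
    intro g hg
    have hfix : ∀ y ∈ orbit L x, g • y = y := by
      rintro _ ⟨k, rfl⟩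
      change g • k • x = k • x
      rw [smul_smul, hL.2.1 g k, ← smul_smul, mem_stabilizer_iff.1 hg]
    have hc : (orbit L x)ᶜ.ncard = 1 := by
      have := Set.ncard_add_ncard_compl (orbit L x)
      simp only [Nat.card_eq_fintype_card, Fintype.card_fin] at this
      omega
    obtain ⟨z, hz⟩ := Set.ncard_eq_one.1 hc
    refine Subgroup.mem_bot.2 (Subtype.ext (Subtype.ext (Equiv.ext fun y ↦ ?_)))
    change g • y = y
    by_cases hy : y ∈ orbit L x
    · exact hfix y hy
    by_cases hgy : g • y ∈ orbit L x
    · exact absurd (mem_orbit_of_mem_orbit g⁻¹ hgy) (by simpa using hy)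
    · have h1 : y ∈ ({z} : Set (Fin 10)) := hz ▸ hy
      have h2 : g • y ∈ ({z} : Set (Fin 10)) := hz ▸ hgy
      exact h2.trans h1.symm
  rw [← Subgroup.index_bot, ← hstab, index_stabilizer, hx9]

theorem eq_of_le_hasLargeOrbit {H K L : Subgroup AltTen} (hH : H ∈ apSet 3 AltTen)
    (hL : L ∈ apSet 3 AltTen) (hL' : HasLargeOrbit L) (hK' : ¬ HasLargeOrbit K)
    (hKL : K ≤ L) (hHK : H ≤ K) : H = K := by
  have hcL := hL'.card_eq hL
  have h1 : Nat.card H ≠ 1 := fun h ↦ hH.1 (Subgroup.card_eq_one.1 h)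
  have h2 := Subgroup.card_dvd_of_le hHK
  have h3 : Nat.card K ∣ 3 ^ 2 := by simpa [hcL] using Subgroup.card_dvd_of_le hKL
  have h4 : Nat.card K ≠ 9 := fun h ↦
    hK' (Subgroup.eq_of_le_of_card_ge hKL (by omega) ▸ hL')
  refine Subgroup.eq_of_le_of_card_ge hHK ?_
  obtain ⟨m, hm, h⟩ := (Nat.dvd_prime_pow Nat.prime_three).1 h3
  rw [h] at h2 h4 ⊢
  obtain ⟨l, hl, h'⟩ := (Nat.dvd_prime_pow Nat.prime_three).1 h2
  rw [h'] at h1 ⊢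
  interval_cases m <;> interval_cases l <;> simp_all

theorem eq_of_adjIn_hasLargeOrbit {H K L : Subgroup AltTen} (hL : HasLargeOrbit L)
    (hH : ¬ HasLargeOrbit H) (hK : ¬ HasLargeOrbit K) (hHK : AdjIn (apSet 3 AltTen) H K)
    (hHL : AdjIn (apSet 3 AltTen) H L) (hKL : AdjIn (apSet 3 AltTen) K L) : H = K := by
  have hHL' : H ≤ L := hHL.2.2.resolve_right fun h ↦ hH (hL.mono h)
  have hKL' : K ≤ L := hKL.2.2.resolve_right fun h ↦ hK (hL.mono h)
  obtain h | h := hHK.2.2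
  · exact eq_of_le_hasLargeOrbit hHK.1 hHL.2.1 hL hK hKL' h
  · exact (eq_of_le_hasLargeOrbit hHK.2.1 hHL.2.1 hL hH hHL' h).symm

/-- `A` is an orbit of `H` with exactly three points. -/
def IsTripleOrbit (H : Subgroup AltTen) (A : Set (Fin 10)) : Prop :=
  A.ncard = 3 ∧ ∃ x, A = orbit H x

theorem exists_isTripleOrbit {H : Subgroup AltTen} (hH : H ∈ apSet 3 AltTen)
    (h : ¬ HasLargeOrbit H) : ∃ A, IsTripleOrbit H A := by
  by_contra! hc
  refine hH.1 (eq_bot_iff.2 fun g hg ↦ Subgroup.mem_bot.2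
    (Subtype.ext (Equiv.ext fun x ↦ ?_)))
  have h1 : (orbit H x).ncard = 1 := by
    rcases card_orbit_of_mem_apSet hH x with h1 | h3 | h9
    · exact h1
    · exact (hc _ ⟨h3, x, rfl⟩).elim
    · exact (h ⟨x, by omega⟩).elim
  obtain ⟨z, hz⟩ := Set.ncard_eq_one.1 h1
  have e1 : x ∈ ({z} : Set (Fin 10)) := hz ▸ mem_orbit_self x
  have e2 : (⟨g, hg⟩ : H) • x ∈ ({z} : Set (Fin 10)) := hz ▸ mem_orbit x _
  exact Eq.trans e2 (Eq.symm e1)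

theorem IsTripleOrbit.mono {H K : Subgroup AltTen} {A : Set (Fin 10)}
    (hA : IsTripleOrbit H A) (hHK : H ≤ K) (hK : ¬ HasLargeOrbit K) : IsTripleOrbit K A := by
  obtain ⟨h3, x, rfl⟩ := hA
  have : orbit H x = orbit K x := by
    refine Set.eq_of_subset_of_ncard_le (orbit_subset_orbit_of_le hHK x) ?_ (Set.toFinite _)
    exact h3 ▸ not_lt.1 fun h ↦ hK ⟨x, h⟩
  exact ⟨h3, x, this⟩

theorem IsTripleOrbit.eq_or_disjoint {H : Subgroup AltTen} {A B : Set (Fin 10)}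
    (hA : IsTripleOrbit H A) (hB : IsTripleOrbit H B) : A = B ∨ Disjoint A B := by
  obtain ⟨-, x, rfl⟩ := hA
  obtain ⟨-, y, rfl⟩ := hB
  exact orbit.eq_or_disjoint x y

theorem stepOneTwo_self (n : ℕ) : stepOneTwo n n = 0 := by
  unfold stepOneTwo
  grind

theorem stepOneTwo_add_comm (m n : ℕ) : stepOneTwo m n + stepOneTwo n m = 0 := by
  unfold stepOneTwo
  grind

theorem stepOneTwo_add_of_disjoint {A B C U : Set (Fin 10)} (hA : A.ncard = 3)
    (hB : B.ncard = 3) (hC : C.ncard = 3) (hU : U.ncard = 5) (hAB : A = B ∨ Disjoint A B)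
    (hBC : B = C ∨ Disjoint B C) (hAC : A = C ∨ Disjoint A C) :
    stepOneTwo (A ∩ U).ncard (B ∩ U).ncard + stepOneTwo (B ∩ U).ncard (C ∩ U).ncard =
      stepOneTwo (A ∩ U).ncard (C ∩ U).ncard := by
  obtain rfl | hAB := hAB
  · rw [stepOneTwo_self, zero_add]
  obtain rfl | hBC := hBC
  · rw [stepOneTwo_self, add_zero]
  obtain rfl | hAC := hAC
  · rw [stepOneTwo_self, stepOneTwo_add_comm]
  have hdisj : Disjoint (A ∪ B) C := Set.disjoint_union_left.2 ⟨hAC, hBC⟩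
  have hcard : (A ∪ B ∪ C).ncard = 9 := by
    rw [Set.ncard_union_eq hdisj, Set.ncard_union_eq hAB, hA, hB, hC]
  have hsum : ((A ∪ B ∪ C) ∩ U).ncard =
      (A ∩ U).ncard + (B ∩ U).ncard + (C ∩ U).ncard := by
    rw [Set.union_inter_distrib_right, Set.union_inter_distrib_right,
      Set.ncard_union_eq, Set.ncard_union_eq (hAB.mono Set.inter_subset_left Set.inter_subset_left)]
    rw [← Set.union_inter_distrib_right]
    exact hdisj.mono Set.inter_subset_left Set.inter_subset_left
  have hle : ((A ∪ B ∪ C) ∩ U).ncard ≤ 5 :=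
    hU ▸ Set.ncard_le_ncard Set.inter_subset_right (Set.toFinite _)
  have hge : 5 ≤ ((A ∪ B ∪ C) ∩ U).ncard + 1 := by
    have h1 := Set.ncard_add_ncard_compl (A ∪ B ∪ C)
    simp only [Nat.card_eq_fintype_card, Fintype.card_fin] at h1
    have h2 := Set.ncard_le_ncard (s := U) (t := ((A ∪ B ∪ C) ∩ U) ∪ (A ∪ B ∪ C)ᶜ)
      (fun x hx ↦ (em (x ∈ A ∪ B ∪ C)).imp (⟨·, hx⟩) id) (Set.toFinite _)
    have h3 := Set.ncard_union_le ((A ∪ B ∪ C) ∩ U) (A ∪ B ∪ C)ᶜ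
    omega
  unfold stepOneTwo
  grind

open Classical in
/-- The number of points of `U` in a chosen three-point orbit of `H`. -/
noncomputable def tripleCount (U : Set (Fin 10)) (H : Subgroup AltTen) : ℕ :=
  if h : ∃ A, IsTripleOrbit H A then (h.choose ∩ U).ncard else 0

theorem exists_tripleCount_eq {H : Subgroup AltTen} (U : Set (Fin 10))
    (h : ∃ A, IsTripleOrbit H A) : ∃ A, IsTripleOrbit H A ∧ tripleCount U H = (A ∩ U).ncard :=
  ⟨h.choose, h.choose_spec, dif_pos h⟩

open Classical in
/-- The cocycle on the poset attached to the counting function `tripleCount U`. -/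
noncomputable def orbitCocycle (U : Set (Fin 10)) (H K : Subgroup AltTen) : ℤ :=
  if HasLargeOrbit H ∨ HasLargeOrbit K then 0
  else stepOneTwo (tripleCount U H) (tripleCount U K)

theorem orbitCocycle_eq_zero_left {U : Set (Fin 10)} {H : Subgroup AltTen}
    (h : HasLargeOrbit H) (K : Subgroup AltTen) : orbitCocycle U H K = 0 :=
  if_pos (.inl h)

theorem orbitCocycle_eq_zero_right {U : Set (Fin 10)} {K : Subgroup AltTen}
    (h : HasLargeOrbit K) (H : Subgroup AltTen) : orbitCocycle U H K = 0 :=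
  if_pos (.inr h)

theorem orbitCocycle_eq {U : Set (Fin 10)} {H K : Subgroup AltTen} (hH : ¬ HasLargeOrbit H)
    (hK : ¬ HasLargeOrbit K) :
    orbitCocycle U H K = stepOneTwo (tripleCount U H) (tripleCount U K) :=
  if_neg (by tauto)

theorem orbitCocycle_eq_zero_of_adjIn {U : Set (Fin 10)} {H K L : Subgroup AltTen}
    (hL : HasLargeOrbit L) (hHK : AdjIn (apSet 3 AltTen) H K)
    (hHL : AdjIn (apSet 3 AltTen) H L) (hKL : AdjIn (apSet 3 AltTen) K L) :
    orbitCocycle U H K = 0 := by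
  by_cases hH : HasLargeOrbit H
  · exact orbitCocycle_eq_zero_left hH K
  by_cases hK : HasLargeOrbit K
  · exact orbitCocycle_eq_zero_right hK H
  rw [eq_of_adjIn_hasLargeOrbit hL hH hK hHK hHL hKL, orbitCocycle_eq hK hK, stepOneTwo_self]

theorem isOneCocycle_orbitCocycle {U : Set (Fin 10)} (hU : U.ncard = 5) :
    IsOneCocycle (apSet 3 AltTen) (orbitCocycle U) := by
  intro x y z hxy hyz hxz
  by_cases hx : HasLargeOrbit x
  · rw [orbitCocycle_eq_zero_left hx, orbitCocycle_eq_zero_left hx,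
      orbitCocycle_eq_zero_of_adjIn hx hyz hxy.symm hxz.symm, add_zero]
  by_cases hy : HasLargeOrbit y
  · rw [orbitCocycle_eq_zero_right hy, orbitCocycle_eq_zero_left hy,
      orbitCocycle_eq_zero_of_adjIn hy hxz hxy hyz.symm, add_zero]
  by_cases hz : HasLargeOrbit z
  · rw [orbitCocycle_eq_zero_right hz, orbitCocycle_eq_zero_right hz,
      orbitCocycle_eq_zero_of_adjIn hz hxy hxz hyz, add_zero]
  obtain ⟨m, hm, hxm, hym, hzm⟩ : ∃ m, ¬ HasLargeOrbit m ∧ x ≤ m ∧ y ≤ m ∧ z ≤ m := by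
    rcases hxy.2.2 with h1 | h1 <;> rcases hyz.2.2 with h2 | h2 <;>
      rcases hxz.2.2 with h3 | h3
    · exact ⟨z, hz, h3, h2, le_rfl⟩
    · exact ⟨z, hz, h1.trans h2, h2, le_rfl⟩
    · exact ⟨y, hy, h1, le_rfl, h2⟩
    · exact ⟨y, hy, h1, le_rfl, h2⟩
    · exact ⟨z, hz, h3, h2, le_rfl⟩
    · exact ⟨x, hx, le_rfl, h1, h3⟩
    · exact ⟨x, hx, le_rfl, h1, h2.trans h1⟩
    · exact ⟨x, hx, le_rfl, h1, h3⟩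
  rw [orbitCocycle_eq hx hy, orbitCocycle_eq hy hz, orbitCocycle_eq hx hz]
  obtain ⟨A, hA, eA⟩ := exists_tripleCount_eq U (exists_isTripleOrbit hxy.1 hx)
  obtain ⟨B, hB, eB⟩ := exists_tripleCount_eq U (exists_isTripleOrbit hyz.1 hy)
  obtain ⟨C, hC, eC⟩ := exists_tripleCount_eq U (exists_isTripleOrbit hxz.2.1 hz)
  rw [eA, eB, eC]
  replace hA := hA.mono hxm hm
  replace hB := hB.mono hym hm
  replace hC := hC.mono hzm hm
  exact stepOneTwo_add_of_disjoint hA.1 hB.1 hC.1 hU (hA.eq_or_disjoint hB)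
    (hB.eq_or_disjoint hC) (hA.eq_or_disjoint hC)

end OrbitCocycle

section ThreeCycles

open MulAction

/-- The triple of letters labelled by a square of the chessboard with four rows and three
columns. -/
def triple (u : Fin 4 × Fin 3) : Finset (Fin 10) :=
  {u.1.castLE (by norm_num), ⟨4 + 2 * u.2, by omega⟩, ⟨5 + 2 * u.2, by omega⟩}

/-- The three-cycle on the letters in `triple u`. -/
def tripleCycle (u : Fin 4 × Fin 3) : AltTen :=
  ⟨Equiv.swap (u.1.castLE (by norm_num)) ⟨4 + 2 * u.2, by omega⟩ *
    Equiv.swap (u.1.castLE (by norm_num)) ⟨5 + 2 * u.2, by omega⟩,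
    Equiv.Perm.mem_alternatingGroup.2 (by revert u; decide +kernel)⟩

theorem card_triple (u : Fin 4 × Fin 3) : (triple u).card = 3 := by
  revert u
  decide +kernel

theorem tripleCycle_ne_one (u : Fin 4 × Fin 3) : tripleCycle u ≠ 1 := by
  revert u
  decide +kernel

theorem tripleCycle_pow_three (u : Fin 4 × Fin 3) : tripleCycle u ^ 3 = 1 := by
  revert u
  decide +kernel

theorem NonAttacking.commute_tripleCycle {u v : Fin 4 × Fin 3} (h : NonAttacking u v) :
    tripleCycle u * tripleCycle v = tripleCycle v * tripleCycle u := by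
  obtain ⟨h1, h2⟩ := h
  revert u v
  decide +kernel

theorem tripleCycle_smul_mem_triple_iff {u v : Fin 4 × Fin 3} (h : u = v ∨ NonAttacking u v) :
    ∀ x, tripleCycle u • x ∈ triple v ↔ x ∈ triple v := by
  unfold NonAttacking at h
  revert u v
  decide +kernel

theorem tripleCycle_smul_of_notMem (u : Fin 4 × Fin 3) :
    ∀ x ∉ triple u, tripleCycle u • x = x := by
  revert u
  decide +kernel

theorem exists_pow_tripleCycle_smul (u : Fin 4 × Fin 3) :
    ∀ x ∈ triple u, ∀ y ∈ triple u, ∃ n : Fin 3, tripleCycle u ^ (n : ℕ) • x = y := by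
  revert u
  decide +kernel

/-- The subgroup generated by the three-cycles labelled by the squares in `C`. -/
def triplesSubgroup (C : Set (Fin 4 × Fin 3)) : Subgroup AltTen :=
  Subgroup.closure (tripleCycle '' C)

theorem triplesSubgroup_mono {C D : Set (Fin 4 × Fin 3)} (h : C ⊆ D) :
    triplesSubgroup C ≤ triplesSubgroup D :=
  Subgroup.closure_mono (Set.image_mono h)

theorem triplesSubgroup_mem_apSet {C : Set (Fin 4 × Fin 3)} (hne : C.Nonempty)
    (hC : C.Pairwise NonAttacking) : triplesSubgroup C ∈ apSet 3 AltTen := by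
  refine closure_mem_apSet ?_ ?_ ?_
  · obtain ⟨u, hu⟩ := hne
    exact ⟨_, ⟨u, hu, rfl⟩, tripleCycle_ne_one u⟩
  · rintro _ ⟨u, hu, rfl⟩ _ ⟨v, hv, rfl⟩
    by_cases h : u = v
    · rw [h]
    · exact (hC hu hv h).commute_tripleCycle
  · rintro _ ⟨u, -, rfl⟩
    exact tripleCycle_pow_three u

theorem smul_mem_iff_of_mem_closure {G α : Type*} [Group G] [MulAction G α] {s : Set G}
    {B : Set α} (h : ∀ g ∈ s, ∀ x, g • x ∈ B ↔ x ∈ B) {g : G} (hg : g ∈ Subgroup.closure s) :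
    ∀ x, g • x ∈ B ↔ x ∈ B := by
  induction hg using Subgroup.closure_induction with
  | mem g hg => exact h g hg
  | one => simp
  | mul a b _ _ iha ihb => exact fun x ↦ by rw [mul_smul, iha, ihb]
  | inv a _ ih => exact fun x ↦ by rw [← ih, smul_inv_smul]

theorem orbit_triplesSubgroup {C : Set (Fin 4 × Fin 3)} (hC : C.Pairwise NonAttacking)
    {u : Fin 4 × Fin 3} (hu : u ∈ C) {x : Fin 10} (hx : x ∈ triple u) :
    orbit (triplesSubgroup C) x = triple u := by
  refine Set.Subset.antisymm ?_ fun y hy ↦ ?_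
  · rintro _ ⟨g, rfl⟩
    refine (smul_mem_iff_of_mem_closure (B := triple u) ?_ g.2 x).2 hx
    rintro _ ⟨v, hv, rfl⟩
    refine tripleCycle_smul_mem_triple_iff ?_
    by_cases h : v = u
    · exact .inl h
    · exact .inr (hC hv hu h)
  · obtain ⟨n, hn⟩ := exists_pow_tripleCycle_smul u x hx y hy
    have hg : tripleCycle u ∈ triplesSubgroup C :=
      Subgroup.subset_closure (Set.mem_image_of_mem _ hu)
    exact ⟨⟨_, pow_mem hg n⟩, hn⟩

theorem orbit_triplesSubgroup_of_notMem {C : Set (Fin 4 × Fin 3)} {x : Fin 10}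
    (hx : ∀ u ∈ C, x ∉ triple u) : orbit (triplesSubgroup C) x = {x} := by
  refine Set.Subset.antisymm ?_ (Set.singleton_subset_iff.2 (mem_orbit_self x))
  rintro _ ⟨g, rfl⟩
  have hg : (g : AltTen) ∈ stabilizer AltTen x := by
    refine (Subgroup.closure_le _).2 ?_ g.2
    rintro _ ⟨u, hu, rfl⟩
    exact tripleCycle_smul_of_notMem u x (hx u hu)
  exact hg

theorem not_hasLargeOrbit_triplesSubgroup {C : Set (Fin 4 × Fin 3)}
    (hC : C.Pairwise NonAttacking) : ¬ HasLargeOrbit (triplesSubgroup C) := by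
  rintro ⟨x, hx⟩
  by_cases h : ∃ u ∈ C, x ∈ triple u
  · obtain ⟨u, hu, hxu⟩ := h
    rw [orbit_triplesSubgroup hC hu hxu, Set.ncard_coe_finset, card_triple] at hx
    exact lt_irrefl _ hx
  · rw [orbit_triplesSubgroup_of_notMem (by simpa using h), Set.ncard_singleton] at hx
    omega

theorem IsTripleOrbit.exists_eq_triple {C : Set (Fin 4 × Fin 3)} {A : Set (Fin 10)}
    (hA : IsTripleOrbit (triplesSubgroup C) A) (hC : C.Pairwise NonAttacking) :
    ∃ u ∈ C, A = triple u := by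
  obtain ⟨h3, x, rfl⟩ := hA
  by_cases h : ∃ u ∈ C, x ∈ triple u
  · obtain ⟨u, hu, hxu⟩ := h
    exact ⟨u, hu, orbit_triplesSubgroup hC hu hxu⟩
  · rw [orbit_triplesSubgroup_of_notMem (by simpa using h), Set.ncard_singleton] at h3
    omega

/-- The five-element set of letters given by two rows of the chessboard, both letters of the first
column and one letter of the second column. -/
def testSet (R : Finset (Fin 4)) : Finset (Fin 10) :=
  R.map (Fin.castLEEmb (by norm_num)) ∪ {4, 5, 6}

theorem card_testSet {R : Finset (Fin 4)} (hR : R.card = 2) : (testSet R).card = 5 := by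
  revert R
  decide +kernel

theorem card_triple_inter_testSet {R : Finset (Fin 4)} (u : Fin 4 × Fin 3) :
    (triple u ∩ testSet R).card = rowCount R u := by
  revert R u
  decide +kernel

theorem exists_tripleCount_triplesSubgroup {C : Set (Fin 4 × Fin 3)} (hne : C.Nonempty)
    (hC : C.Pairwise NonAttacking) (R : Finset (Fin 4)) :
    ∃ u ∈ C, tripleCount (testSet R) (triplesSubgroup C) = rowCount R u := by
  obtain ⟨A, hA, e⟩ := exists_tripleCount_eq (testSet R) (exists_isTripleOrbit
    (triplesSubgroup_mem_apSet hne hC) (not_hasLargeOrbit_triplesSubgroup hC))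
  obtain ⟨u, hu, rfl⟩ := hA.exists_eq_triple hC
  exact ⟨u, hu, by rw [e, ← Finset.coe_inter, Set.ncard_coe_finset, card_triple_inter_testSet]⟩

theorem tripleCount_triplesSubgroup_singleton (u : Fin 4 × Fin 3) (R : Finset (Fin 4)) :
    tripleCount (testSet R) (triplesSubgroup {u}) = rowCount R u := by
  obtain ⟨_, rfl, h⟩ := exists_tripleCount_triplesSubgroup (Set.singleton_nonempty u)
    (Set.pairwise_singleton u _) R
  exact h

end ThreeCycles

theorem NonAttacking.symm {u v : Fin 4 × Fin 3} (h : NonAttacking u v) : NonAttacking v u :=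
  ⟨h.1.symm, h.2.symm⟩

theorem NonAttacking.pairwise_pair {u v : Fin 4 × Fin 3} (h : NonAttacking u v) :
    ({u, v} : Set (Fin 4 × Fin 3)).Pairwise NonAttacking := by
  rintro _ (rfl | rfl) _ (rfl | rfl) hne
  exacts [absurd rfl hne, h, h.symm, absurd rfl hne]

theorem NonAttacking.pairwise_triple {u v w : Fin 4 × Fin 3} (huv : NonAttacking u v)
    (hvw : NonAttacking v w) (huw : NonAttacking u w) :
    ({u, v, w} : Set (Fin 4 × Fin 3)).Pairwise NonAttacking := by
  rintro _ (rfl | rfl | rfl) _ (rfl | rfl | rfl) hne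
  exacts [absurd rfl hne, huv, huw, huv.symm, absurd rfl hne, hvw, huw.symm, hvw.symm,
    absurd rfl hne]

theorem adjIn_triplesSubgroup {C D : Set (Fin 4 × Fin 3)} (hne : C.Nonempty) (hCD : C ⊆ D)
    (hD : D.Pairwise NonAttacking) :
    AdjIn (apSet 3 AltTen) (triplesSubgroup C) (triplesSubgroup D) :=
  ⟨triplesSubgroup_mem_apSet hne (hD.mono hCD),
    triplesSubgroup_mem_apSet (hne.mono hCD) hD, .inl (triplesSubgroup_mono hCD)⟩

theorem isChessboardLabelling_of_edge_labelling {G : Type*} [Group G]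
    {g : Subgroup AltTen → Subgroup AltTen → G}
    (hg : ∀ x y z, AdjIn (apSet 3 AltTen) x y → AdjIn (apSet 3 AltTen) y z →
      AdjIn (apSet 3 AltTen) x z → g x y * g y z = g x z) :
    IsChessboardLabelling fun u v ↦
      g (triplesSubgroup {u}) (triplesSubgroup {u, v}) *
        g (triplesSubgroup {u, v}) (triplesSubgroup {v}) := by
  have hself : ∀ x ∈ apSet 3 AltTen, g x x = 1 := fun x hx ↦ by
    have h : AdjIn (apSet 3 AltTen) x x := ⟨hx, hx, .inl le_rfl⟩
    simpa using hg x x x h h h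
  have hinv : ∀ x y, AdjIn (apSet 3 AltTen) x y → g x y * g y x = 1 := fun x y h ↦ by
    rw [hg x y x h h.symm ⟨h.1, h.1, .inl le_rfl⟩, hself x h.1]
  have hthrough : ∀ {D : Set (Fin 4 × Fin 3)} {u v : Fin 4 × Fin 3},
      D.Pairwise NonAttacking → u ∈ D → v ∈ D →
      g (triplesSubgroup {u}) (triplesSubgroup {u, v}) *
        g (triplesSubgroup {u, v}) (triplesSubgroup {v}) =
      g (triplesSubgroup {u}) (triplesSubgroup D) *
        g (triplesSubgroup D) (triplesSubgroup {v}) := by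
    intro D u v hD hu hv
    have hsub : {u, v} ⊆ D := Set.insert_subset hu (Set.singleton_subset_iff.2 hv)
    have huv := adjIn_triplesSubgroup (Set.insert_nonempty u {v}) hsub hD
    have hu1 := adjIn_triplesSubgroup (C := {u}) (D := {u, v}) (Set.singleton_nonempty u)
      (by simp) (hD.mono hsub)
    have hv1 := adjIn_triplesSubgroup (C := {v}) (D := {u, v}) (Set.singleton_nonempty v)
      (by simp) (hD.mono hsub)
    have hu2 := adjIn_triplesSubgroup (Set.singleton_nonempty u)
      (Set.singleton_subset_iff.2 hu) hD
    have hv2 := adjIn_triplesSubgroup (Set.singleton_nonempty v)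
      (Set.singleton_subset_iff.2 hv) hD
    rw [← hg _ _ _ hu1 huv hu2, mul_assoc, hg _ _ _ huv hv2.symm hv1.symm]
  constructor
  · intro u v huv
    have hD := huv.pairwise_pair
    have hu := adjIn_triplesSubgroup (C := {u}) (Set.singleton_nonempty u) (by simp) hD
    have hv := adjIn_triplesSubgroup (C := {v}) (Set.singleton_nonempty v) (by simp) hD
    rw [hthrough (u := v) (v := u) hD (by simp) (by simp), mul_assoc,
      ← mul_assoc (g _ (triplesSubgroup {v})), hinv _ _ hv.symm, one_mul, hinv _ _ hu]
  · intro u v w huv hvw huw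
    have hD := huv.pairwise_triple hvw huw
    have hv := adjIn_triplesSubgroup (C := {v}) (Set.singleton_nonempty v) (by simp) hD
    rw [hthrough hD (by simp) (by simp), hthrough (u := v) hD (by simp) (by simp),
      hthrough (u := u) (v := w) hD (by simp) (by simp), mul_assoc,
      ← mul_assoc (g _ (triplesSubgroup {v})), hinv _ _ hv.symm, one_mul]

end AltTen

/-- The poset `A_3(A₁₀)` of nontrivial elementary abelian 3-subgroups
of the alternating group on 10 letters is connected, and its fundamental group is not
a free group. -/
theorem stmt5 :
    ConnectedSpace ↥(geomRealOn (apSet 3 ↥(alternatingGroup (Fin 10)))) ∧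
    ∀ x : ↥(geomRealOn (apSet 3 ↥(alternatingGroup (Fin 10)))),
      ¬ ∃ S : Type, Nonempty
        (FundamentalGroup ↥(geomRealOn (apSet 3 ↥(alternatingGroup (Fin 10)))) x ≃*
          FreeGroup S) := by
  have hpc : PathConnectedSpace (geomRealOn (apSet 3 AltTen)) :=
    pathConnectedSpace_geomRealOn_apSet
  refine ⟨inferInstanceAs (ConnectedSpace (geomRealOn (apSet 3 AltTen))), fun p ↦ ?_⟩
  rintro ⟨S, ⟨φ⟩⟩
  have : Fintype (Subgroup AltTen) := Fintype.ofFinite _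
  obtain ⟨g, hg, hd⟩ := exists_edge_labelling (S := apSet 3 AltTen) p
  refine (isChessboardLabelling_of_edge_labelling hg).not_mulEquiv_freeGroup
    (fun R hR ↦ ?_) S φ
  obtain ⟨W, q, hW⟩ := hd _ (isOneCocycle_orbitCocycle (U := testSet R)
    (by rw [Set.ncard_coe_finset, card_testSet hR]))
  refine ⟨W, fun u ↦ q (triplesSubgroup {u}), fun u v huv ↦ ?_⟩
  have hD := huv.pairwise_pair
  have hu := adjIn_triplesSubgroup (C := {u}) (Set.singleton_nonempty u) (by simp) hD
  have hv := adjIn_triplesSubgroup (C := {v}) (Set.singleton_nonempty v) (by simp) hD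
  have hu' := not_hasLargeOrbit_triplesSubgroup (Set.pairwise_singleton u NonAttacking)
  have hv' := not_hasLargeOrbit_triplesSubgroup (Set.pairwise_singleton v NonAttacking)
  have hD' := not_hasLargeOrbit_triplesSubgroup hD
  obtain ⟨w, hw, hcount⟩ :=
    exists_tripleCount_triplesSubgroup (Set.insert_nonempty u {v}) hD R
  rw [map_mul, toAdd_mul, hW _ _ hu, hW _ _ hv.symm, orbitCocycle_eq hD' hu',
    orbitCocycle_eq hv' hD', hcount, tripleCount_triplesSubgroup_singleton,
    tripleCount_triplesSubgroup_singleton]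
  obtain rfl | rfl := hw
  · rw [stepOneTwo_self]
    push_cast
    ring
  · rw [stepOneTwo_self]
    push_cast
    ring
end

section
/- Let X be a finite poset whose order complex K(X) is connected, and let Y ⊆ X be a subposet such that any two distinct elements of X − Y are incomparable in X. If the geometric realization of K(Y) is simply connected, then the fundamental group of the geometric realization of K(X) is a free group. -/
open Function

/-- To prove that all homotopy classes of paths satisfy a property stable under concatenation,
it suffices to check it on the paths contained in some member of an open cover. -/
theorem Path.Homotopic.Quotient.induction_of_openCover {T ι : Type*} [TopologicalSpace T]
    {c : ι → Set T} (hc : ∀ i, IsOpen (c i)) (hcov : ⋃ i, c i = Set.univ)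
    {P : ∀ x y : T, Path.Homotopic.Quotient x y → Prop}
    (htrans : ∀ (x y z : T) (p : Path.Homotopic.Quotient x y) (q : Path.Homotopic.Quotient y z),
      P x y p → P y z q → P x z (p.trans q))
    (hpiece : ∀ (i : ι) (x y : T) (γ : Path x y), (∀ t, γ t ∈ c i) → P x y (.mk γ))
    {x y : T} (p : Path.Homotopic.Quotient x y) : P x y p := by
  induction p using Path.Homotopic.Quotient.ind with | _ γ
  obtain ⟨t, ht0, hmono, ⟨n, hn⟩, hsub⟩ :=
    exists_monotone_Icc_subset_open_cover_unitInterval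
      (fun i ↦ (hc i).preimage γ.continuous) (by rw [← Set.preimage_iUnion, hcov]; simp)
  have hsubpath (k : ℕ) :
      P (γ (t k)) (γ (t (k + 1))) (.mk (γ.subpath (t k) (t (k + 1)))) := by
    obtain ⟨i, hi⟩ := hsub k
    refine hpiece i _ _ _ fun s ↦ ?_
    have := Set.mem_range_self (f := γ.subpath (t k) (t (k + 1))) s
    rw [Path.range_subpath_of_le _ _ _ (hmono k.le_succ)] at this
    obtain ⟨u, hu, hus⟩ := this
    exact hus ▸ hi hu
  have hpartial (k : ℕ) : P (γ (t 0)) (γ (t (k + 1))) (.mk (γ.subpath (t 0) (t (k + 1)))) := by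
    induction k with
    | zero => exact hsubpath 0
    | succ k ih =>
      have := htrans _ _ _ _ _ ih (hsubpath (k + 1))
      rwa [← Path.Homotopic.Quotient.mk_trans, Path.Homotopic.Quotient.eq.2
        ⟨Path.Homotopy.subpathTransSubpath γ _ _ _⟩] at this
  have key : P (γ 0) (γ 1) (.mk (γ.subpath 0 1)) := by
    have := hpartial n
    rwa [ht0, hn (n + 1) n.le_succ] at this
  rw [Path.subpath_zero_one, Path.Homotopic.Quotient.mk_cast] at key
  have hs : ∀ a b (ha : a = x) (hb : b = y),
      P a b ((Path.Homotopic.Quotient.mk γ).cast ha hb) → P x y (.mk γ) := by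
    rintro a b rfl rfl h
    simpa using h
  exact hs _ _ _ _ key

/-- The point of the total space with coordinate `g` in the `i`-th chart over `x`. -/
def FiberBundleCore.fiberPoint {ι B F : Type*} [TopologicalSpace B] [TopologicalSpace F]
    (Z : FiberBundleCore ι B F) (i : ι) (x : B) (g : F) : Z.proj ⁻¹' {x} :=
  ⟨⟨x, Z.coordChange i (Z.indexAt x) x g⟩, rfl⟩

/-- Paths lying in the base set of one chart lift to paths with constant coordinate. -/
theorem FiberBundleCore.monodromy_fiberPoint {ι B F : Type*} [TopologicalSpace B]
    [TopologicalSpace F] (Z : FiberBundleCore ι B F) (cov : IsCoveringMap Z.proj) (i : ι)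
    {x y : B} (γ : Path x y) (hγ : ∀ t, γ t ∈ Z.baseSet i) (g : F) :
    cov.monodromy (.mk γ) (Z.fiberPoint i x g) = Z.fiberPoint i y g := by
  have hcont : Continuous fun t ↦ (Z.localTriv i).toOpenPartialHomeomorph.symm (γ t, g) := by
    refine (Z.localTriv i).continuousOn_invFun.comp_continuous (by fun_prop) fun t ↦ ?_
    exact (Z.mem_localTriv_target i _).2 (hγ t)
  let Γ : Path (Z.fiberPoint i x g).1 (Z.fiberPoint i y g).1 :=
    { toFun := fun t ↦ (Z.localTriv i).toOpenPartialHomeomorph.symm (γ t, g)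
      continuous_toFun := hcont
      source' := by simp [FiberBundleCore.fiberPoint]
      target' := by simp [FiberBundleCore.fiberPoint] }
  refine cov.monodromy_eq_of_map_eq (.mk Γ) ?_
  rw [← Path.Homotopic.Quotient.mk_map]
  rfl

/-- The principal bundle over `B` with discrete fibre `G` glued from trivial bundles over the open
sets `U i` along the transition functions `(a j)⁻¹ * a i`. -/
def FiberBundleCore.ofTransition {ι B G : Type*} [TopologicalSpace B] [Group G]
    [TopologicalSpace G] [DiscreteTopology G] (U : ι → Set B) (hU : ∀ i, IsOpen (U i))
    (indexAt : B → ι) (hmem : ∀ x, x ∈ U (indexAt x)) (a : ι → B → G)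
    (ha : ∀ i j, ∀ x ∈ U i ∩ U j, ∀ᶠ y in nhds x, y ∈ U i ∩ U j →
      (a j y)⁻¹ * a i y = (a j x)⁻¹ * a i x) : FiberBundleCore ι B G where
  baseSet := U
  isOpen_baseSet := hU
  indexAt := indexAt
  mem_baseSet_at := hmem
  coordChange i j x g := (a j x)⁻¹ * a i x * g
  coordChange_self i x _ g := by simp
  continuousOn_coordChange i j := by
    rintro ⟨x, g⟩ ⟨hx, -⟩
    have hx' : U i ∩ U j ∈ nhds x := ((hU i).inter (hU j)).mem_nhds hx
    refine ContinuousAt.continuousWithinAt ?_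
    have hcont : ContinuousAt (fun p : B × G ↦ (a j x)⁻¹ * a i x * p.2) (x, g) :=
      (continuous_of_discreteTopology (f := fun h : G ↦ (a j x)⁻¹ * a i x * h)).continuousAt.comp
        continuousAt_snd
    refine hcont.congr ?_
    filter_upwards [continuousAt_fst.eventually (ha i j x hx), continuousAt_fst.eventually hx']
      with p hp hp'
    simp only [hp hp']
  coordChange_comp i j k x _ g := by simp [mul_assoc]

/-- Every set admits a choice of one representative in each of its path components. -/
theorem exists_pathComponent_representative {T : Type*} [TopologicalSpace T] (A : Set T) :
    ∃ ρ : T → T, (∀ x ∈ A, JoinedIn A x (ρ x)) ∧ ∀ x y, JoinedIn A x y → ρ x = ρ y := by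
  classical
  refine ⟨fun x ↦ @Classical.epsilon T ⟨x⟩ (JoinedIn A x), fun x hx ↦ ?_, fun x y hxy ↦ ?_⟩
  · exact @Classical.epsilon_spec T (JoinedIn A x) ⟨x, JoinedIn.refl hx⟩
  · have : JoinedIn A x = JoinedIn A y :=
      funext fun z ↦ propext ⟨fun h ↦ hxy.symm.trans h, fun h ↦ hxy.trans h⟩
    simp only [this]

/-- If each path component of `A` meets `W ⊆ A`, then one can choose a representative in `W` of each
path component of `A` and, compatibly, of each path component of `W`. -/
theorem exists_compatible_representatives {T : Type*} [TopologicalSpace T] {A W : Set T}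
    (hWA : W ⊆ A) (hmeet : ∀ v ∈ A, ∃ w ∈ W, JoinedIn A v w) :
    ∃ ρ r : T → T, (∀ x ∈ W, JoinedIn W x (ρ x)) ∧ (∀ x y, JoinedIn W x y → ρ x = ρ y) ∧
      (∀ v ∈ A, r v ∈ W ∧ JoinedIn A v (r v)) ∧ (∀ x y, JoinedIn A x y → r x = r y) ∧
      ∀ v ∈ A, ρ (r v) = r v := by
  obtain ⟨ρ, hρ, hρ'⟩ := exists_pathComponent_representative W
  obtain ⟨r, hr, hr'⟩ := exists_pathComponent_representative A
  choose! m hmW hm using hmeet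
  have hrm (v : T) (hv : v ∈ A) : m (r v) ∈ W := hmW _ (hr v hv).target_mem
  refine ⟨ρ, fun v ↦ ρ (m (r v)), hρ, hρ', fun v hv ↦ ⟨(hρ _ (hrm v hv)).target_mem, ?_⟩,
    fun x y hxy ↦ by simp only [hr' x y hxy],
    fun v hv ↦ (hρ' _ _ (hρ _ (hrm v hv))).symm⟩
  exact ((hr v hv).trans (hm _ (hr v hv).target_mem)).trans ((hρ _ (hrm v hv)).mono hWA)

namespace Path.Homotopic.Quotient

variable {T : Type*} [TopologicalSpace T] {x y z : T}

theorem trans_symm_cancel_left (p : Path.Homotopic.Quotient x y)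
    (q : Path.Homotopic.Quotient x z) : p.trans (p.symm.trans q) = q := by
  rw [← trans_assoc, trans_symm, refl_trans]

theorem symm_trans_cancel_left (p : Path.Homotopic.Quotient x y)
    (q : Path.Homotopic.Quotient y z) : p.symm.trans (p.trans q) = q := by
  rw [← trans_assoc, symm_trans, refl_trans]

theorem symm_symm (p : Path.Homotopic.Quotient x y) : p.symm.symm = p := by
  induction p using Path.Homotopic.Quotient.ind with | _ γ
  rw [← mk_symm, ← mk_symm, Path.symm_symm]

theorem trans_symm_rev (p : Path.Homotopic.Quotient x y) (q : Path.Homotopic.Quotient y z) :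
    (p.trans q).symm = q.symm.trans p.symm := by
  induction p using Path.Homotopic.Quotient.ind with | _ γ
  induction q using Path.Homotopic.Quotient.ind with | _ γ'
  rw [← mk_trans, ← mk_symm, ← mk_symm, ← mk_symm, ← mk_trans, Path.trans_symm]

end Path.Homotopic.Quotient

section UnionFree

variable {T : Type*} [TopologicalSpace T] {U V : Set T} {x₀ : T}

/-- The class of some path from `x` to `y` inside `A`. -/
noncomputable def pathClassIn {A : Set T} {x y : T} (h : JoinedIn A x y) :
    Path.Homotopic.Quotient x y :=
  .mk h.somePath

theorem mk_eq_pathClassIn {A : Set T}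
    (hA : ∀ (x y : T) (p q : Path x y), (∀ t, p t ∈ A) → (∀ t, q t ∈ A) → p.Homotopic q)
    {x y : T} {γ : Path x y} (hγ : ∀ t, γ t ∈ A) (h : JoinedIn A x y) :
    .mk γ = pathClassIn h :=
  Path.Homotopic.Quotient.eq.2 (hA _ _ _ _ hγ h.somePath_mem)

theorem pathClassIn_symm {A : Set T}
    (hA : ∀ (x y : T) (p q : Path x y), (∀ t, p t ∈ A) → (∀ t, q t ∈ A) → p.Homotopic q)
    {x y : T} (h : JoinedIn A x y) : (pathClassIn h).symm = pathClassIn h.symm :=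
  mk_eq_pathClassIn hA (γ := h.somePath.symm) (fun _ ↦ h.somePath_mem _) _

theorem pathClassIn_trans {A : Set T}
    (hA : ∀ (x y : T) (p q : Path x y), (∀ t, p t ∈ A) → (∀ t, q t ∈ A) → p.Homotopic q)
    {x y z : T} (h : JoinedIn A x y) (h' : JoinedIn A y z) :
    (pathClassIn h).trans (pathClassIn h') = pathClassIn (h.trans h') := by
  refine mk_eq_pathClassIn hA (γ := h.somePath.trans h'.somePath) (fun t ↦ ?_) _
  rw [Path.trans_apply]
  split_ifs
  exacts [h.somePath_mem _, h'.somePath_mem _]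

/-- The loop that runs inside `U` from `x₀` to `s`, inside `V` from `s` to `r`, and back inside
`U`. -/
noncomputable def bridgeLoop (hU : ∀ x ∈ U, JoinedIn U x₀ x) {s r : T} (hs : s ∈ U) (hr : r ∈ U)
    (hsr : JoinedIn V s r) : FundamentalGroup T x₀ :=
  .fromPath (((pathClassIn (hU s hs)).trans (pathClassIn hsr)).trans (pathClassIn (hU r hr)).symm)

/-- A space which is the union of two open sets, in each of which parallel paths are homotopic,
has fundamental group generated by the loops crossing from the first set to the second. -/
theorem mem_subgroup_of_bridgeLoop_mem (hUo : IsOpen U) (hVo : IsOpen V) (hUV : U ∪ V = Set.univ)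
    (hU : ∀ x ∈ U, JoinedIn U x₀ x)
    (hUh : ∀ (x y : T) (p q : Path x y), (∀ t, p t ∈ U) → (∀ t, q t ∈ U) → p.Homotopic q)
    (hVh : ∀ (x y : T) (p q : Path x y), (∀ t, p t ∈ V) → (∀ t, q t ∈ V) → p.Homotopic q)
    (hx₀ : x₀ ∈ U) {r : T → T} (hrU : ∀ v ∈ V, r v ∈ U) (hrV : ∀ v ∈ V, JoinedIn V v (r v))
    (hr : ∀ x y, JoinedIn V x y → r x = r y) (N : Subgroup (FundamentalGroup T x₀))
    (hN : ∀ w (hwU : w ∈ U) (hwV : w ∈ V),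
      bridgeLoop hU hwU (hrU w hwV) (hrV w hwV) ∈ N) (g : FundamentalGroup T x₀) : g ∈ N := by
  classical
  let β (t : T) (ht : t ∈ V) : Path.Homotopic.Quotient x₀ t :=
    (pathClassIn (hU _ (hrU t ht))).trans (pathClassIn (hrV t ht)).symm
  let α (t : T) : Path.Homotopic.Quotient x₀ t :=
    if h : t ∈ U then pathClassIn (hU t h) else
      β t ((hUV.symm ▸ Set.mem_univ t : t ∈ U ∪ V).resolve_left h)
  have hαU (t : T) (ht : t ∈ U) : α t = pathClassIn (hU t ht) := dif_pos ht
  have hmul {a b : Path.Homotopic.Quotient x₀ x₀} (ha : FundamentalGroup.fromPath a ∈ N)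
      (hb : FundamentalGroup.fromPath b ∈ N) : FundamentalGroup.fromPath (a.trans b) ∈ N :=
    N.mul_mem hb ha
  have hinv {a : Path.Homotopic.Quotient x₀ x₀} (ha : FundamentalGroup.fromPath a ∈ N) :
      FundamentalGroup.fromPath a.symm ∈ N :=
    N.inv_mem ha
  have hone : FundamentalGroup.fromPath (Path.Homotopic.Quotient.refl x₀) ∈ N := N.one_mem
  have hαβ (t : T) (ht : t ∈ V) : FundamentalGroup.fromPath ((α t).trans (β t ht).symm) ∈ N := by
    by_cases h : t ∈ U
    · convert hN t h ht using 1
      rw [hαU t h]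
      simp only [β, bridgeLoop, Path.Homotopic.Quotient.trans_symm_rev,
        Path.Homotopic.Quotient.symm_symm, Path.Homotopic.Quotient.trans_assoc]
    · have : α t = β t ht := dif_neg h
      rw [this, Path.Homotopic.Quotient.trans_symm]
      exact hone
  have key := Path.Homotopic.Quotient.induction_of_openCover
    (c := fun b : Bool ↦ bif b then U else V)
    (by rintro (_ | _) <;> simpa) (by rw [← Set.union_eq_iUnion, hUV])
    (P := fun x y p ↦ FundamentalGroup.fromPath (((α x).trans p).trans (α y).symm) ∈ N)
    (fun x y z p q hp hq ↦ by
      have := hmul hp hq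
      simpa only [Path.Homotopic.Quotient.trans_assoc,
        Path.Homotopic.Quotient.symm_trans_cancel_left] using this)
    (fun i x y γ hγ ↦ by
      have hx := hγ 0
      have hy := hγ 1
      rw [γ.source] at hx
      rw [γ.target] at hy
      cases i with
      | true =>
        simp only [cond_true] at hx hy hγ
        rw [hαU x hx, hαU y hy, mk_eq_pathClassIn hUh hγ ((hU x hx).symm.trans (hU y hy)),
          pathClassIn_trans hUh, Path.Homotopic.Quotient.trans_symm]
        exact hone
      | false =>
        simp only [cond_false] at hx hy hγ
        have hxy : JoinedIn V x y := ⟨γ, hγ⟩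
        have hβ : (β x hx).trans (.mk γ) = β y hy := by
          have hrxy := hr x y hxy
          have hyx : JoinedIn V y (r x) := hrxy ▸ hrV y hy
          have hβy (s : T) (hs : s = r y) (hUs : JoinedIn U x₀ s) (h : JoinedIn V y s) :
              β y hy = (pathClassIn hUs).trans (pathClassIn h).symm := by
            subst hs
            rfl
          rw [hβy _ hrxy (hU _ (hrU x hx)) hyx, mk_eq_pathClassIn hVh hγ hxy]
          simp only [β]
          rw [pathClassIn_symm hVh, pathClassIn_symm hVh, Path.Homotopic.Quotient.trans_assoc,
            pathClassIn_trans hVh]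
        have := hmul (hαβ x hx) (hinv (hαβ y hy))
        rw [← hβ] at this
        simpa only [Path.Homotopic.Quotient.trans_assoc, Path.Homotopic.Quotient.symm_symm,
          Path.Homotopic.Quotient.trans_symm_rev,
          Path.Homotopic.Quotient.symm_trans_cancel_left] using this)
      (FundamentalGroup.toPath g)
  have h₀ : α x₀ = .refl x₀ := by
    rw [hαU x₀ hx₀, ← Path.Homotopic.Quotient.mk_refl]
    exact Path.Homotopic.Quotient.eq.2 (hUh _ _ _ _ (JoinedIn.somePath_mem _) fun _ ↦ hx₀)
  rw [h₀, Path.Homotopic.Quotient.refl_trans, ← Path.Homotopic.Quotient.mk_refl,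
    ← Path.Homotopic.Quotient.mk_symm, Path.refl_symm, Path.Homotopic.Quotient.mk_refl,
    Path.Homotopic.Quotient.trans_refl] at key
  exact key


theorem monodromy_bridgeLoop {ι F : Type*} [TopologicalSpace F] (Z : FiberBundleCore ι T F)
    (cov : IsCoveringMap Z.proj) {i j : ι} (hiU : Z.baseSet i = U) (hjV : Z.baseSet j = V)
    (hU : ∀ x ∈ U, JoinedIn U x₀ x) {s r : T} (hs : s ∈ U) (hr : r ∈ U)
    (hsr : JoinedIn V s r) (g g' : F)
    (hg : Z.coordChange j i r (Z.coordChange i j s g) = g') :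
    cov.monodromyPerm x₀ (bridgeLoop hU hs hr hsr) (Z.fiberPoint i x₀ g) =
      Z.fiberPoint i x₀ g' := by
  subst hiU hjV
  have hs' : Z.fiberPoint i s g = Z.fiberPoint j s (Z.coordChange i j s g) := by
    refine Subtype.ext (congrArg (Bundle.TotalSpace.mk s) ?_)
    exact (Z.coordChange_comp _ _ _ s ⟨⟨hs, hsr.source_mem⟩, Z.mem_baseSet_at s⟩ g).symm
  have hr' : Z.fiberPoint j r (Z.coordChange i j s g) = Z.fiberPoint i r g' := by
    refine Subtype.ext (congrArg (Bundle.TotalSpace.mk r) ?_)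
    rw [← hg]
    exact (Z.coordChange_comp _ _ _ r ⟨⟨hsr.target_mem, hr⟩, Z.mem_baseSet_at r⟩ _).symm
  rw [IsCoveringMap.coe_monodromyPerm, bridgeLoop]
  change cov.monodromy (((pathClassIn (hU s hs)).trans (pathClassIn hsr)).trans
    (pathClassIn (hU r hr)).symm) _ = _
  rw [IsCoveringMap.monodromy_trans_apply, IsCoveringMap.monodromy_trans_apply, pathClassIn,
    pathClassIn, pathClassIn, ← Path.Homotopic.Quotient.mk_symm,
    Z.monodromy_fiberPoint cov i _ (hU s hs).somePath_mem, hs',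
    Z.monodromy_fiberPoint cov j _ hsr.somePath_mem, hr']
  exact Z.monodromy_fiberPoint (g := g') cov i (hU r hr).somePath.symm
    fun t ↦ (hU r hr).somePath_mem _

/-- Moving the starting point of a bridge inside a path component of `U ∩ V` does not change its
loop. -/
theorem bridgeLoop_congr (hU : ∀ x ∈ U, JoinedIn U x₀ x)
    (hUh : ∀ (x y : T) (p q : Path x y), (∀ t, p t ∈ U) → (∀ t, q t ∈ U) → p.Homotopic q)
    (hVh : ∀ (x y : T) (p q : Path x y), (∀ t, p t ∈ V) → (∀ t, q t ∈ V) → p.Homotopic q)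
    {s s' r r' : T} (h : JoinedIn (U ∩ V) s s') (hrr' : r = r') (hs : s ∈ U) (hs' : s' ∈ U)
    (hr : r ∈ U) (hr' : r' ∈ U) (hsr : JoinedIn V s r) (hsr' : JoinedIn V s' r') :
    bridgeLoop hU hs hr hsr = bridgeLoop hU hs' hr' hsr' := by
  subst hrr'
  have h1 : pathClassIn (hU s' hs') =
      (pathClassIn (hU s hs)).trans (pathClassIn (h.mono Set.inter_subset_left)) := by
    rw [pathClassIn_trans hUh]
  have h2 : pathClassIn (h.mono Set.inter_subset_left) =
      pathClassIn (h.mono Set.inter_subset_right) :=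
    (mk_eq_pathClassIn hUh (fun t ↦ (h.somePath_mem t).1) _).symm.trans
      (mk_eq_pathClassIn hVh (fun t ↦ (h.somePath_mem t).2) _)
  have h3 : pathClassIn hsr =
      (pathClassIn (h.mono Set.inter_subset_right)).trans (pathClassIn hsr') := by
    rw [pathClassIn_trans hVh]
  simp only [bridgeLoop, h1, h2, h3, Path.Homotopic.Quotient.trans_assoc]

theorem bridgeLoop_self (hU : ∀ x ∈ U, JoinedIn U x₀ x)
    (hVh : ∀ (x y : T) (p q : Path x y), (∀ t, p t ∈ V) → (∀ t, q t ∈ V) → p.Homotopic q)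
    {s : T} (hs hs' : s ∈ U) (h : JoinedIn V s s) : bridgeLoop hU hs hs' h = 1 := by
  have h1 : pathClassIn h = .refl s := by
    rw [← Path.Homotopic.Quotient.mk_refl]
    exact (mk_eq_pathClassIn hVh (fun _ ↦ h.source_mem) h).symm
  rw [bridgeLoop, h1, Path.Homotopic.Quotient.trans_refl, Path.Homotopic.Quotient.trans_symm]
  rfl

/-- Let `T = U ∪ V` with `U` and `V` open, such that parallel paths in `U` or in `V` are homotopic,
`U` is path connected, every path component of `V` meets `U` and the path components of `U ∩ V` are
open. Then the fundamental group of `T` is free. -/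
theorem fundamentalGroup_free_of_open_union (hUo : IsOpen U) (hVo : IsOpen V)
    (hUV : U ∪ V = Set.univ) (hx₀ : x₀ ∈ U) (hU : ∀ x ∈ U, JoinedIn U x₀ x)
    (hUh : ∀ (x y : T) (p q : Path x y), (∀ t, p t ∈ U) → (∀ t, q t ∈ U) → p.Homotopic q)
    (hVh : ∀ (x y : T) (p q : Path x y), (∀ t, p t ∈ V) → (∀ t, q t ∈ V) → p.Homotopic q)
    (hmeet : ∀ v ∈ V, ∃ w ∈ U ∩ V, JoinedIn V v w)
    (hloc : ∀ w ∈ U ∩ V, ∀ᶠ x in nhds w, x ∈ U ∩ V → JoinedIn (U ∩ V) w x) :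
    ∃ S : Set T, Nonempty (FundamentalGroup T x₀ ≃* FreeGroup S) := by
  classical
  obtain ⟨ρ, r, hρ, hρ', hr, hr', hρr⟩ :=
    exists_compatible_representatives (Set.inter_subset_right (s := U) (t := V)) hmeet
  let S : Set T := {s | s ∈ U ∩ V ∧ ρ s = s ∧ r s ≠ s}
  refine ⟨S, ?_⟩
  let G := FreeGroup S
  let _ : TopologicalSpace G := ⊥
  have : DiscreteTopology G := ⟨rfl⟩
  let e (x : T) : G := if h : ρ x ∈ S then FreeGroup.of ⟨ρ x, h⟩ else 1
  have heS (s : S) : e s = FreeGroup.of s := by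
    have hs : ρ s.1 = s := s.2.2.1
    have : ρ s.1 ∈ S := hs.symm ▸ s.2
    simp only [e, dif_pos this]
    congr 1
    exact Subtype.ext hs
  have her (v : T) (hv : v ∈ V) : e (r v) = 1 :=
    dif_neg fun h ↦ h.2.2 (by rw [hρr v hv, hr' _ _ (hr v hv).2.symm])
  have heW (x y : T) (h : JoinedIn (U ∩ V) x y) : e x = e y := by
    simp only [e, hρ' x y h]
  let a (b : Bool) (x : T) : G := bif b then e x else 1
  let Z : FiberBundleCore Bool T G := .ofTransition (fun b ↦ bif b then U else V)
    (by rintro (_ | _) <;> simpa) (fun x ↦ decide (x ∈ U))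
    (fun x ↦ by
      by_cases h : x ∈ U
      · simp [h]
      · simpa [h] using (hUV.symm ▸ Set.mem_univ x : x ∈ U ∪ V).resolve_left h) a
    (by
      rintro (_ | _) (_ | _) x hx
      · simp
      · filter_upwards [hloc x hx.symm] with y hy hy'
        simp [a, heW x y (hy hy'.symm)]
      · filter_upwards [hloc x hx] with y hy hy'
        simp [a, heW x y (hy hy')]
      · simp)
  have hZU : Z.baseSet true = U := rfl
  have hZV : Z.baseSet false = V := rfl
  have cov : IsCoveringMap Z.proj := FiberBundle.isCoveringMap (F := G) (E := Z.Fiber)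
  let ψ : FreeGroup S →* FundamentalGroup T x₀ := FreeGroup.lift fun s ↦
    bridgeLoop hU s.2.1.1 (hr s s.2.1.2).1.1 (hr s s.2.1.2).2
  have hψof (s : S) : ψ (FreeGroup.of s) =
      bridgeLoop hU s.2.1.1 (hr s s.2.1.2).1.1 (hr s s.2.1.2).2 := FreeGroup.lift_apply_of
  have hpt (g : FreeGroup S) : ∀ h : G, cov.monodromyPerm x₀ (ψ g) (Z.fiberPoint true x₀ h) =
      Z.fiberPoint true x₀ (g * h) := by
    have hof (s : S) (h : G) :
        cov.monodromyPerm x₀ (ψ (FreeGroup.of s)) (Z.fiberPoint true x₀ h) =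
          Z.fiberPoint true x₀ (FreeGroup.of s * h) := by
      rw [hψof]
      refine monodromy_bridgeLoop (i := true) (j := false) (U := U) (V := V) Z cov hZU hZV hU
        _ _ _ _ _ ?_
      change (e (r s))⁻¹ * 1 * ((1 : G)⁻¹ * e s * h) = _
      rw [her s s.2.1.2, heS]
      simp
    induction g using FreeGroup.induction_on with
    | C1 => intro h; rw [map_one, map_one, Equiv.Perm.one_apply, one_mul]
    | of s => exact hof s
    | inv_of s _ =>
      intro h
      rw [map_inv, map_inv, Equiv.Perm.inv_eq_iff_eq, hof, mul_inv_cancel_left]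
    | mul x y hx hy => intro h; rw [map_mul, map_mul, Equiv.Perm.mul_apply, hy, hx, mul_assoc]
  refine ⟨(MulEquiv.ofBijective ψ ⟨?_, fun g ↦ ?_⟩).symm⟩
  · rw [injective_iff_map_eq_one]
    intro g hg
    have h1 := hpt g 1
    rw [hg, map_one, Equiv.Perm.one_apply, mul_one] at h1
    have h2 : (a (decide (x₀ ∈ U)) x₀)⁻¹ * a true x₀ * 1 =
        (a (decide (x₀ ∈ U)) x₀)⁻¹ * a true x₀ * g := by
      have := congrArg Subtype.val h1
      exact eq_of_heq (Bundle.TotalSpace.mk.inj this).2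
    exact (mul_left_cancel h2).symm
  · refine mem_subgroup_of_bridgeLoop_mem hUo hVo hUV hU hUh hVh hx₀ (fun v hv ↦ (hr v hv).1.1)
      (fun v hv ↦ (hr v hv).2) hr' ψ.range (fun w hwU hwV ↦ ?_) g
    have hw : JoinedIn (U ∩ V) w (ρ w) := hρ w ⟨hwU, hwV⟩
    have hrw : r w = r (ρ w) := hr' _ _ (hw.mono Set.inter_subset_right)
    have hm := hw.target_mem
    by_cases h : ρ w ∈ S
    · exact ⟨.of ⟨ρ w, h⟩, (hψof _).trans
        (bridgeLoop_congr hU hUh hVh hw hrw hwU hm.1 _ _ _ _).symm⟩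
    · have hrρ : r (ρ w) = ρ w := by
        by_contra hne
        exact h ⟨hm, (hρ' _ _ hw).symm, hne⟩
      rw [bridgeLoop_congr hU hUh hVh hw (hrw.trans hrρ) hwU hm.1 _ hm.1 _ (.refl hm.2),
        bridgeLoop_self hU hVh]
      exact one_mem _

end UnionFree

section Subspaces

variable {E : Type*} [TopologicalSpace E] {A K : Set E}

theorem JoinedIn.preimage_val (hAK : A ⊆ K) {x y : K} (h : JoinedIn A (x : E) y) :
    JoinedIn (Subtype.val ⁻¹' A) x y :=
  ⟨{ toFun := fun t ↦ ⟨h.somePath t, hAK (h.somePath_mem t)⟩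
     continuous_toFun := by fun_prop
     source' := by simp
     target' := by simp }, h.somePath_mem⟩

theorem Path.homotopic_of_simplyConnected_subspace (hAK : A ⊆ K) [SimplyConnectedSpace A] {x y : K}
    (p q : Path x y) (hp : ∀ t, (p t : E) ∈ A) (hq : ∀ t, (q t : E) ∈ A) : p.Homotopic q := by
  have hx : (x : E) ∈ A := by simpa using hp 0
  have hy : (y : E) ∈ A := by simpa using hp 1
  let p' : Path (⟨x, hx⟩ : A) ⟨y, hy⟩ :=
    { toFun := fun t ↦ ⟨p t, hp t⟩
      continuous_toFun := by fun_prop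
      source' := by simp
      target' := by simp }
  let q' : Path (⟨x, hx⟩ : A) ⟨y, hy⟩ :=
    { toFun := fun t ↦ ⟨q t, hq t⟩
      continuous_toFun := by fun_prop
      source' := by simp
      target' := by simp }
  exact (SimplyConnectedSpace.paths_homotopic p' q').map
    ⟨Set.inclusion hAK, continuous_inclusion hAK⟩

end Subspaces

section GeometricRealization

theorem continuous_coe_apply {X : Type*} (A : Set (X → ℝ)) (x : X) : Continuous fun f : A ↦ f.1 x :=
  (continuous_apply x).comp continuous_subtype_val

variable {X : Type*} [PartialOrder X] {Y : Set X}

theorem geomRealOn_mono {S S' : Set X} (h : S ⊆ S') : geomRealOn S ⊆ geomRealOn S' :=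
  fun _ hf ↦ ⟨hf.1, hf.2.1.trans h, hf.2.2⟩

theorem eq_of_apply_ne_zero_of_isAntichain (hanti : IsAntichain (· ≤ ·) Yᶜ) {S : Set X}
    {f : X → ℝ} (hf : f ∈ geomRealOn S) {z z' : X} (hz : z ∉ Y) (hz' : z' ∉ Y) (h : f z ≠ 0)
    (h' : f z' ≠ 0) : z = z' := by
  rcases hf.2.2.1.total h h' with hle | hle
  exacts [hanti.eq hz hz' hle, (hanti.eq hz' hz hle).symm]

/-- The complement in the realization of `X` of the vertices outside `Y`. -/
def awayFromVertices (Y : Set X) : Set (X → ℝ) :=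
  {f | f ∈ geomRealOn Set.univ ∧ ∀ z ∉ Y, f z < 1}

/-- The open star of the vertex `z` in the realization of `X`. -/
def openStar (z : X) : Set (X → ℝ) :=
  {f | f ∈ geomRealOn Set.univ ∧ 0 < f z}

theorem geomRealOn_subset_awayFromVertices : geomRealOn Y ⊆ awayFromVertices Y := by
  refine fun f hf ↦ ⟨geomRealOn_mono (Set.subset_univ Y) hf, fun z hz ↦ ?_⟩
  have : f z = 0 := by
    by_contra h
    exact hz (hf.2.1 h)
  rw [this]
  exact one_pos

/-- A path in the union of the open stars of the vertices outside `Y` stays in one of them. -/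
theorem forall_mem_openStar_of_path (hanti : IsAntichain (· ≤ ·) Yᶜ)
    {x y : geomRealOn (Set.univ : Set X)} (p : Path x y)
    (hp : ∀ t, ∃ z ∉ Y, 0 < (p t : X → ℝ) z) {z : X} (hz : z ∉ Y) (hx : 0 < (x : X → ℝ) z) :
    ∀ t, (p t : X → ℝ) ∈ openStar z := by
  have hopen (z : X) : IsOpen {t | 0 < (p t : X → ℝ) z} :=
    isOpen_lt continuous_const ((continuous_coe_apply _ z).comp p.continuous)
  have hcompl : {t | 0 < (p t : X → ℝ) z}ᶜ =
      ⋃ z' : {z' // z' ∉ Y ∧ z' ≠ z}, {t | 0 < (p t : X → ℝ) z'} := by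
    ext t
    simp only [Set.mem_compl_iff, Set.mem_ofPred_eq, Set.mem_iUnion, Subtype.exists]
    constructor
    · intro ht
      obtain ⟨z', hz', h⟩ := hp t
      exact ⟨z', ⟨hz', by rintro rfl; exact ht h⟩, h⟩
    · rintro ⟨z', ⟨hz', hne⟩, h⟩ ht
      exact hne (eq_of_apply_ne_zero_of_isAntichain hanti (p t).2 hz' hz h.ne' ht.ne')
  have hclopen : IsClopen {t | 0 < (p t : X → ℝ) z} :=
    ⟨⟨hcompl ▸ isOpen_iUnion fun z' ↦ hopen z'⟩, hopen z⟩
  exact fun t ↦ ⟨(p t).2, Set.eq_univ_iff_forall.1 (hclopen.eq_univ ⟨0, by simpa using hx⟩) t⟩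

/-- If the realization of `X` is connected, each open star of a vertex outside `Y` contains points
other than its vertex. -/
theorem exists_mem_openStar_lt_one [ConnectedSpace (geomRealOn (Set.univ : Set X))]
    (hanti : IsAntichain (· ≤ ·) Yᶜ) (hY : (geomRealOn Y).Nonempty) {z : X} (hz : z ∉ Y)
    (hne : (openStar z).Nonempty) : ∃ f ∈ openStar z, ∀ z' ∉ Y, f z' < 1 := by
  by_contra! h
  have heq : {f : geomRealOn (Set.univ : Set X) | 0 < f.1 z} = {f | 1 ≤ f.1 z} := by
    ext f
    refine ⟨fun hf ↦ ?_, fun hf : 1 ≤ f.1 z ↦ zero_lt_one.trans_le hf⟩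
    obtain ⟨z', hz', hf'⟩ := h f.1 ⟨f.2, hf⟩
    rwa [← eq_of_apply_ne_zero_of_isAntichain hanti f.2 hz' hz (one_pos.trans_le hf').ne' hf.ne']
  have hclopen : IsClopen {f : geomRealOn (Set.univ : Set X) | 0 < f.1 z} :=
    ⟨heq ▸ isClosed_le continuous_const (continuous_coe_apply _ z),
      isOpen_lt continuous_const (continuous_coe_apply _ z)⟩
  obtain ⟨f, hf⟩ := hne
  have huniv := hclopen.eq_univ ⟨⟨f, hf.1⟩, hf.2⟩
  obtain ⟨g, hg⟩ := hY
  have : (⟨g, geomRealOn_mono (Set.subset_univ Y) hg⟩ : geomRealOn (Set.univ : Set X)) ∈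
    {f : geomRealOn (Set.univ : Set X) | 0 < f.1 z} := huniv ▸ Set.mem_univ _
  exact hz (hg.2.1 this.ne')

variable [Fintype X]

theorem mem_geomRealOn_iff {S : Set X} {f : X → ℝ} :
    f ∈ geomRealOn S ↔ (∀ x, 0 ≤ f x) ∧ support f ⊆ S ∧ IsChain (· ≤ ·) (support f) ∧
      ∑ x, f x = 1 := by
  refine and_congr_right fun _ ↦ and_congr_right fun _ ↦ and_congr_right fun _ ↦
    ⟨?_, fun h ↦ ⟨Finset.univ, by simp, h⟩⟩
  rintro ⟨s, hs, h⟩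
  rw [← h]
  refine (Finset.sum_subset (Finset.subset_univ s) fun x _ hx ↦ ?_).symm
  by_contra hne
  exact hx (hs hne)

/-- The realization contains the segment between two points lying in a common closed simplex. -/
theorem convexCombination_mem_geomRealOn {S : Set X} {f g : X → ℝ} (hf : f ∈ geomRealOn S)
    (hg : g ∈ geomRealOn S) (hfg : support f ⊆ support g) {a b : ℝ} (ha : 0 ≤ a) (hb : 0 ≤ b)
    (hab : a + b = 1) : a • f + b • g ∈ geomRealOn S := by
  rw [mem_geomRealOn_iff] at *
  have hsupp : support (a • f + b • g) ⊆ support g := by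
    intro x hx hgx
    have hfx : f x = 0 := by
      by_contra h
      exact hfg h hgx
    exact hx (by simp [hfx, hgx])
  refine ⟨fun x ↦ ?_, hsupp.trans hg.2.1, hg.2.2.1.mono hsupp, ?_⟩
  · have := mul_nonneg ha (hf.1 x)
    have := mul_nonneg hb (hg.1 x)
    simp only [Pi.add_apply, Pi.smul_apply, smul_eq_mul]
    positivity
  · simp [Finset.sum_add_distrib, ← Finset.mul_sum, hf.2.2.2, hg.2.2.2, hab]

theorem openStar_contractibleSpace (z : X) : ContractibleSpace (openStar z) := by
  classical
  have hsupp : support (Pi.single z 1 : X → ℝ) = {z} := by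
    ext x
    simp
  have hz : (Pi.single z 1 : X → ℝ) ∈ openStar z := by
    refine ⟨mem_geomRealOn_iff.2 ⟨fun x ↦ ?_, Set.subset_univ _, ?_, by simp⟩, by simp⟩
    · rw [Pi.single_apply]
      positivity
    · rw [hsupp]
      exact Set.subsingleton_singleton.isChain
  refine StarConvex.contractibleSpace (x := Pi.single z 1) (fun f hf a b ha hb hab ↦
    ⟨convexCombination_mem_geomRealOn hz.1 hf.1 ?_ ha hb hab, ?_⟩) ⟨_, hz⟩
  · rw [hsupp, Set.singleton_subset_iff]
    exact hf.2.ne'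
  · have := hf.2
    simp only [Pi.add_apply, Pi.smul_apply, Pi.single_eq_same, smul_eq_mul, mul_one]
    rcases ha.eq_or_lt with rfl | ha
    · rw [zero_add] at hab
      simpa [hab]
    · positivity

theorem sum_indicator_pos (hanti : IsAntichain (· ≤ ·) Yᶜ) {f : X → ℝ}
    (hf : f ∈ awayFromVertices Y) : 0 < ∑ x, Y.indicator f x := by
  obtain ⟨hf, hlt⟩ := hf
  have hf' := mem_geomRealOn_iff.1 hf
  refine (Finset.sum_nonneg fun x _ ↦ Set.indicator_nonneg (fun x _ ↦ hf.1 x) x).lt_of_ne'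
    fun h0 ↦ ?_
  have hzero : ∀ y ∈ Y, f y = 0 := fun y hy ↦ by
    have := (Finset.sum_eq_zero_iff_of_nonneg
      fun x _ ↦ Set.indicator_nonneg (fun x _ ↦ hf.1 x) x).1 h0 y (Finset.mem_univ y)
    rwa [Set.indicator_of_mem hy] at this
  obtain ⟨z, -, hz⟩ : ∃ z ∈ Finset.univ, f z ≠ 0 := by
    refine Finset.exists_ne_zero_of_sum_ne_zero ?_
    rw [hf'.2.2.2]
    exact one_ne_zero
  have hzY : z ∉ Y := fun h ↦ hz (hzero z h)
  refine (hlt z hzY).ne ?_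
  rw [← hf'.2.2.2]
  refine (Fintype.sum_eq_single z fun x hx ↦ ?_).symm
  by_contra hne
  exact hx (eq_of_apply_ne_zero_of_isAntichain hanti hf (fun h ↦ hne (hzero x h)) hzY hne hz)

/-- The projection of a function to the functions supported on `Y` with total mass one. -/
noncomputable def normalizedRestrict (Y : Set X) (f : X → ℝ) : X → ℝ :=
  (∑ x, Y.indicator f x)⁻¹ • Y.indicator f

theorem normalizedRestrict_mem (hanti : IsAntichain (· ≤ ·) Yᶜ) {f : X → ℝ}
    (hf : f ∈ awayFromVertices Y) : normalizedRestrict Y f ∈ geomRealOn Y := by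
  have hpos := sum_indicator_pos hanti hf
  have hsupp : support (normalizedRestrict Y f) ⊆ Y ∩ support f :=
    (support_const_smul_subset _ _).trans (Set.support_indicator).subset
  refine mem_geomRealOn_iff.2 ⟨fun x ↦ ?_, hsupp.trans Set.inter_subset_left,
    hf.1.2.2.1.mono (hsupp.trans Set.inter_subset_right), ?_⟩
  · exact mul_nonneg (inv_nonneg.2 hpos.le) (Set.indicator_nonneg (fun x _ ↦ hf.1.1 x) x)
  · simp only [normalizedRestrict, Pi.smul_apply, smul_eq_mul, ← Finset.mul_sum]
    exact inv_mul_cancel₀ hpos.ne'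

theorem normalizedRestrict_of_mem {f : X → ℝ} (hf : f ∈ geomRealOn Y) :
    normalizedRestrict Y f = f := by
  have hfY : Y.indicator f = f := Set.indicator_eq_self.2 hf.2.1
  rw [normalizedRestrict, hfY, (mem_geomRealOn_iff.1 hf).2.2.2, inv_one, one_smul]

theorem continuous_normalizedRestrict (hanti : IsAntichain (· ≤ ·) Yᶜ) :
    Continuous fun f : awayFromVertices Y ↦ normalizedRestrict Y (f : X → ℝ) := by
  classical
  have hind : Continuous fun f : awayFromVertices Y ↦ Y.indicator (f : X → ℝ) := by
    refine continuous_pi fun x ↦ ?_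
    by_cases hx : x ∈ Y
    · simp only [Set.indicator_of_mem hx]
      exact continuous_coe_apply _ x
    · simp only [Set.indicator_of_notMem hx]
      fun_prop
  refine Continuous.smul (Continuous.inv₀ ?_ fun f ↦ (sum_indicator_pos hanti f.2).ne') hind
  exact continuous_finsetSum _ fun x _ ↦ (continuous_apply x).comp hind

/-- The realization of `Y` is a deformation retract of the complement of the other vertices. -/
noncomputable def awayFromVerticesHomotopyEquiv (hanti : IsAntichain (· ≤ ·) Yᶜ) :
    ContinuousMap.HomotopyEquiv (awayFromVertices Y) (geomRealOn Y) where
  toFun := ⟨fun f ↦ ⟨normalizedRestrict Y f, normalizedRestrict_mem hanti f.2⟩,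
    (continuous_normalizedRestrict hanti).subtype_mk _⟩
  invFun := ⟨Set.inclusion geomRealOn_subset_awayFromVertices, continuous_inclusion _⟩
  left_inv := ⟨
    { toFun := fun p ↦ ⟨(1 - p.1 : ℝ) • normalizedRestrict Y p.2 + (p.1 : ℝ) • (p.2 : X → ℝ), by
        have hr := normalizedRestrict_mem hanti p.2.2
        refine ⟨convexCombination_mem_geomRealOn (geomRealOn_mono (Set.subset_univ Y) hr) p.2.2.1 ?_
          (sub_nonneg.2 p.1.2.2) p.1.2.1 (by ring), fun z hz ↦ ?_⟩
        · exact (support_const_smul_subset _ _).trans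
            (Set.support_indicator.subset.trans Set.inter_subset_right)
        · have hrz : normalizedRestrict Y p.2 z = 0 := by
            by_contra h
            exact hz (hr.2.1 h)
          simp only [Pi.add_apply, Pi.smul_apply, smul_eq_mul, hrz, mul_zero, zero_add]
          exact (mul_le_of_le_one_left (p.2.2.1.1 z) p.1.2.2).trans_lt (p.2.2.2 z hz)⟩
      continuous_toFun := by
        have := (continuous_normalizedRestrict hanti).comp
          (continuous_snd (X := unitInterval) (Y := awayFromVertices Y))
        have h₁ : Continuous fun p : unitInterval × awayFromVertices Y ↦ (1 - p.1 : ℝ) := by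
          fun_prop
        have h₂ : Continuous fun p : unitInterval × awayFromVertices Y ↦
            (p.1 : ℝ) • (p.2 : X → ℝ) := by
          fun_prop
        exact ((h₁.smul this).add h₂).subtype_mk _
      map_zero_left := fun f ↦ Subtype.ext (by simp)
      map_one_left := fun f ↦ Subtype.ext (by simp) }⟩
  right_inv := by
    convert ContinuousMap.Homotopic.refl _
    ext1 f
    exact Subtype.ext (normalizedRestrict_of_mem f.2).symm

/-- Near a point of the punctured open stars, the punctured open stars are locally path
connected. -/
theorem eventually_joinedIn_punctured_openStar {w : geomRealOn (Set.univ : Set X)}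
    (hw : ∃ z ∉ Y, 0 < w.1 z) (hw1 : ∀ z ∉ Y, w.1 z < 1) :
    ∀ᶠ g in nhds w, (∀ z ∉ Y, g.1 z < 1) →
      JoinedIn {f : geomRealOn (Set.univ : Set X) |
        (∀ z ∉ Y, f.1 z < 1) ∧ ∃ z ∉ Y, 0 < f.1 z} w g := by
  have hev : ∀ᶠ g : geomRealOn (Set.univ : Set X) in nhds w, ∀ x, 0 < w.1 x → 0 < g.1 x := by
    refine Filter.eventually_all.2 fun x ↦ ?_
    by_cases hx : 0 < w.1 x
    · filter_upwards [(continuous_coe_apply _ x).continuousAt.eventually (lt_mem_nhds hx)]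
        with g hg _ using hg
    · exact .of_forall fun _ h ↦ absurd h hx
  filter_upwards [hev] with g hg hg1
  have hsub : segment ℝ w.1 g.1 ⊆ {f | f ∈ geomRealOn (Set.univ : Set X) ∧
      (∀ z ∉ Y, f z < 1) ∧ ∃ z ∉ Y, 0 < f z} := by
    rintro _ ⟨a, b, ha, hb, hab, rfl⟩
    refine ⟨convexCombination_mem_geomRealOn w.2 g.2 (fun x hx ↦ ?_) ha hb hab, fun z hz ↦ ?_, ?_⟩
    · exact (hg x ((w.2.1 x).lt_of_ne' hx)).ne'
    · exact convex_Iio (1 : ℝ) (hw1 z hz) (hg1 z hz) ha hb hab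
    · obtain ⟨z, hz, hwz⟩ := hw
      exact ⟨z, hz, convex_Ioi (0 : ℝ) hwz (hg z hwz) ha hb hab⟩
  exact ((JoinedIn.of_segment_subset hsub).preimage_val fun f hf ↦ hf.1).mono fun f hf ↦ hf.2

end GeometricRealization

/-- Let `X` be a finite poset whose order complex is connected and let
`Y ⊆ X` be a subposet such that any two distinct elements of `X − Y` are incomparable.
If the realization of `K(Y)` is simply connected, then the fundamental group of the
realization of `K(X)` is free. -/
theorem stmt6 (X : Type) [PartialOrder X] [Finite X] (Y : Set X)
    (hanti : IsAntichain (· ≤ ·) Yᶜ)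
    (hconn : ConnectedSpace ↥(geomRealOn (Set.univ : Set X)))
    (hY : SimplyConnectedSpace ↥(geomRealOn Y)) :
    ∀ x : ↥(geomRealOn (Set.univ : Set X)), ∃ S : Type,
      Nonempty (FundamentalGroup ↥(geomRealOn (Set.univ : Set X)) x ≃* FreeGroup S) := by
  intro x
  cases nonempty_fintype X
  let T := ↥(geomRealOn (Set.univ : Set X))
  let U : Set T := {f | ∀ z ∉ Y, f.1 z < 1}
  let V : Set T := {f | ∃ z ∉ Y, 0 < f.1 z}
  have hUo : IsOpen U := by
    simp only [U, Set.ofPred_forall]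
    exact isOpen_iInter_of_finite fun z ↦ isOpen_iInter_of_finite fun _ ↦
      isOpen_lt (continuous_coe_apply _ z) continuous_const
  have hVo : IsOpen V := by
    have : V = ⋃ z, ⋃ (_ : z ∉ Y), {f : T | 0 < f.1 z} := by
      ext f
      simp [V]
    rw [this]
    exact isOpen_iUnion fun z ↦ isOpen_iUnion fun _ ↦
      isOpen_lt continuous_const (continuous_coe_apply _ z)
  have hUV : U ∪ V = Set.univ := by
    refine Set.eq_univ_of_forall fun f ↦ or_iff_not_imp_left.2 fun hf ↦ ?_
    obtain ⟨z, hz, h⟩ : ∃ z ∉ Y, 1 ≤ f.1 z := by simpa [U] using hf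
    exact ⟨z, hz, zero_lt_one.trans_le h⟩
  have hUs : SimplyConnectedSpace (awayFromVertices Y) :=
    (awayFromVerticesHomotopyEquiv hanti).simplyConnectedSpace
  have hYne : (geomRealOn Y).Nonempty :=
    Set.nonempty_coe_sort.1 (inferInstance : Nonempty (geomRealOn Y))
  have hUpath : IsPathConnected (awayFromVertices Y) :=
    isPathConnected_iff_pathConnectedSpace.2 inferInstance
  have hVpath (z : X) : IsPathConnected (openStar z) :=
    have := openStar_contractibleSpace z
    isPathConnected_iff_pathConnectedSpace.2 inferInstance
  obtain ⟨f₀, hf₀⟩ := hUpath.nonempty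
  let x₀ : T := ⟨f₀, hf₀.1⟩
  have hU (f : T) (hf : f ∈ U) : JoinedIn U x₀ f :=
    ((hUpath.joinedIn _ hf₀ f.1 ⟨f.2, hf⟩).preimage_val (x := x₀) fun _ h ↦ h.1).mono
      fun _ h ↦ h.2
  have hmeet (v : T) (hv : v ∈ V) : ∃ w ∈ U ∩ V, JoinedIn V v w := by
    obtain ⟨z, hz, hvz⟩ := hv
    obtain ⟨w, hw, hw1⟩ := exists_mem_openStar_lt_one hanti hYne hz ⟨v.1, v.2, hvz⟩
    refine ⟨⟨w, hw.1⟩, ⟨hw1, z, hz, hw.2⟩, ?_⟩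
    exact (((hVpath z).joinedIn v.1 ⟨v.2, hvz⟩ w hw).preimage_val (y := ⟨w, hw.1⟩)
      fun _ h ↦ h.1).mono fun _ h ↦ ⟨z, hz, h.2⟩
  have hUh (a b : T) (p q : Path a b) (hp : ∀ t, p t ∈ U) (hq : ∀ t, q t ∈ U) : p.Homotopic q :=
    p.homotopic_of_simplyConnected_subspace (A := awayFromVertices Y) (fun _ h ↦ h.1) q
      (fun t ↦ ⟨(p t).2, hp t⟩) fun t ↦ ⟨(q t).2, hq t⟩
  have hVh (a b : T) (p q : Path a b) (hp : ∀ t, p t ∈ V) (hq : ∀ t, q t ∈ V) :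
      p.Homotopic q := by
    obtain ⟨z, hz, ha⟩ : a ∈ V := by simpa using hp 0
    have := openStar_contractibleSpace z
    exact p.homotopic_of_simplyConnected_subspace (A := openStar z) (fun _ h ↦ h.1) q
      (forall_mem_openStar_of_path hanti p hp hz ha) (forall_mem_openStar_of_path hanti q hq hz ha)
  obtain ⟨S, ⟨e⟩⟩ := fundamentalGroup_free_of_open_union hUo hVo hUV (x₀ := x₀) hf₀.2 hU hUh hVh
    hmeet fun w hw ↦ (eventually_joinedIn_punctured_openStar hw.2 hw.1).mono fun _ h h' ↦ h h'.1
  have hx : Joined x x₀ := by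
    rcases (hUV.symm ▸ Set.mem_univ x : x ∈ U ∪ V) with h | h
    · exact (hU x h).joined.symm
    · obtain ⟨w, hw, hxw⟩ := hmeet x h
      exact hxw.joined.trans (hU w hw.1).joined.symm
  exact ⟨S, ⟨(FundamentalGroup.fundamentalGroupMulEquivOfPath hx.somePath).trans e⟩⟩
end
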